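/- Fix i ∈ {1, 2}. Let ν be a finite Borel measure on Ω and let g ∈ C(∂Ω) admit an extension g̃ ∈ C(Ω̄) which is convex in Ω. Let (f_h)_{h>0} with f_h : Ω_h → [0,∞) be such that the normalized counting measures B ↦ h^d Σ_{x ∈ B ∩ Ω_h} f_h(x) converge weakly to ν as h → 0 (i.e., for every sequence h_k → 0 and every Borel set B ⊂ Ω with ν(∂B ∩ Ω) = 0 the values converge to ν(B)), and such that h^d Σ_{x ∈ Ω_h} f_h(x) ≤ A for a constant A independent of h. Suppose that for each h > 0, u_h is a discrete convex mesh function satisfying M^i_h[u_h](x) = h^d f_h(x) for all x ∈ Ω_h and u_h(x) = g̃(x) for all x ∈ ∂Ω_h. Then u_h converges uniformly on compact subsets of Ω to the unique convex function u ∈ C(Ω̄) satisfying M[u] = ν on Ω and u = g on ∂Ω (the Aleksandrov solution of det D²u = ν in Ω, u = g on ∂Ω). -/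

import Mathlib

open MeasureTheory Filter
open scoped RealInnerProductSpace ENNReal Topology

noncomputable section

/-- `ℝ^d` with the Euclidean structure. -/
abbrev Ed (d : ℕ) := EuclideanSpace ℝ (Fin d)

/-- The lattice `ℤ^d_h = {mh : m ∈ ℤ^d}`. -/
def lat (d : ℕ) (h : ℝ) : Set (Ed d) :=
  {x | ∃ m : Fin d → ℤ, ∀ i, x i = (m i : ℝ) * h}

/-- `e` is an orthogonal basis of `ℝ^d` (i.e. `d` pairwise orthogonal nonzero vectors),
with all `e i ∈ ℤ^d_h` and `x ± e i ∈ Ω̄ ∩ ℤ^d_h` for all `i`. -/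
def admB (d : ℕ) (Ω : Set (Ed d)) (h : ℝ) (x : Ed d) (e : Fin d → Ed d) : Prop :=
  (∀ i, e i ∈ lat d h) ∧ (∀ i, e i ≠ 0) ∧
  (∀ i j, i ≠ j → ⟪e i, e j⟫ = 0) ∧
  (∀ i, x + e i ∈ closure Ω ∩ lat d h) ∧ (∀ i, x - e i ∈ closure Ω ∩ lat d h)

/-- The first discrete normal mapping `∂¹_h u_h(x)`. -/
def subdiff1 (d : ℕ) (Ω : Set (Ed d)) (h : ℝ) (u : Ed d → ℝ) (x : Ed d) : Set (Ed d) :=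
  {p | ∀ e : Fin d → Ed d, admB d Ω h x e → ∀ i,
    u x - u (x - e i) ≤ ⟪p, e i⟫ ∧ ⟪p, e i⟫ ≤ u (x + e i) - u x}

/-- `∂¹_h u_h(E) = ⋃_{x ∈ E ∩ ℤ^d_h} ∂¹_h u_h(x)`. -/
def subdiff1Set (d : ℕ) (Ω : Set (Ed d)) (h : ℝ) (u : Ed d → ℝ) (s : Set (Ed d)) :
    Set (Ed d) :=
  ⋃ x ∈ s ∩ lat d h, subdiff1 d Ω h u x

/-- The second discrete normal mapping `∂²_h u_h(x)`. -/
def subdiff2 (d : ℕ) (Ω : Set (Ed d)) (h : ℝ) (u : Ed d → ℝ) (x : Ed d) : Set (Ed d) :=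
  {p | ∀ e ∈ lat d h, x + e ∈ closure Ω ∩ lat d h → x - e ∈ closure Ω ∩ lat d h →
    u x - u (x - e) ≤ ⟪p, e⟫ ∧ ⟪p, e⟫ ≤ u (x + e) - u x}

/-- `∂²_h u_h(E) = ⋃_{x ∈ E ∩ ℤ^d_h} ∂²_h u_h(x)`. -/
def subdiff2Set (d : ℕ) (Ω : Set (Ed d)) (h : ℝ) (u : Ed d → ℝ) (s : Set (Ed d)) :
    Set (Ed d) :=
  ⋃ x ∈ s ∩ lat d h, subdiff2 d Ω h u x

/-- The interior mesh points `Ω_h`. -/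
def meshInt (d : ℕ) (Ω : Set (Ed d)) (h : ℝ) : Set (Ed d) :=
  {x ∈ Ω ∩ lat d h | ∀ i : Fin d,
    x + h • (EuclideanSpace.single i (1 : ℝ)) ∈ closure Ω ∩ lat d h ∧
    x - h • (EuclideanSpace.single i (1 : ℝ)) ∈ closure Ω ∩ lat d h}

/-- A mesh function is discrete convex if `Δ_e u(x) ≥ 0` for all `x ∈ Ω_h` and all
admissible `e ∈ ℤ^d_h`. -/
def DiscConvex (d : ℕ) (Ω : Set (Ed d)) (h : ℝ) (u : Ed d → ℝ) : Prop :=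
  ∀ x ∈ meshInt d Ω h, ∀ e ∈ lat d h,
    x + e ∈ closure Ω ∩ lat d h → x - e ∈ closure Ω ∩ lat d h →
    0 ≤ u (x + e) - 2 * u x + u (x - e)

/-- Oberman's discrete Monge–Ampère operator `M⁰_h[u](x)`. -/
def M0 (d : ℕ) (Ω : Set (Ed d)) (h : ℝ) (u : Ed d → ℝ) (x : Ed d) : ℝ :=
  sInf {t | ∃ e : Fin d → Ed d, admB d Ω h x e ∧
    t = ∏ i, (u (x + e i) - 2 * u x + u (x - e i)) / ‖e i‖}

/-- The normal mapping (subdifferential) `∂u(x₀)` of `u : Ω → ℝ`. -/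
def nmap (d : ℕ) (Ω : Set (Ed d)) (u : Ed d → ℝ) (x₀ : Ed d) : Set (Ed d) :=
  {p | ∀ x ∈ Ω, u x₀ + ⟪p, x - x₀⟫ ≤ u x}

/-- `∂u(E) = ⋃_{x ∈ E} ∂u(x)`. -/
def nmapSet (d : ℕ) (Ω : Set (Ed d)) (u : Ed d → ℝ) (s : Set (Ed d)) : Set (Ed d) :=
  ⋃ x ∈ s, nmap d Ω u x

/-- The closed ball of radius `ε` around `x₀` in the maximum norm. -/
def ballMax (d : ℕ) (x₀ : Ed d) (ε : ℝ) : Set (Ed d) := {y | ∀ i, |y i - x₀ i| ≤ ε}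

/-- The family of mesh functions `uh` converges to `u` uniformly on compact subsets of `Ω`. -/
def CvgUnifCpt (d : ℕ) (Ω : Set (Ed d)) (uh : ℝ → Ed d → ℝ) (u : Ed d → ℝ) : Prop :=
  ∀ K : Set (Ed d), K ⊆ Ω → IsCompact K →
    ∀ hk : ℕ → ℝ, (∀ n, 0 < hk n) → Tendsto hk atTop (𝓝 0) →
    ∀ ε > (0 : ℝ), ∃ N : ℕ, ∀ n ≥ N, ∀ x ∈ K ∩ lat d (hk n), |uh (hk n) x - u x| < ε

/-- The boundary condition: for any positive sequence `h_k → 0`, any subsequence and any mesh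
points `z_{k_j} ∈ Ω ∩ ℤ^d_{h_{k_j}}` converging to a boundary point,
`liminf u(z_{k_j}) ≤ limsup u_{h_{k_j}}(z_{k_j})`. -/
def BdryCond (d : ℕ) (Ω : Set (Ed d)) (uh : ℝ → Ed d → ℝ) (u : Ed d → ℝ) : Prop :=
  ∀ hk : ℕ → ℝ, (∀ n, 0 < hk n) → Tendsto hk atTop (𝓝 0) →
  ∀ φ : ℕ → ℕ, StrictMono φ →
  ∀ z : ℕ → Ed d, (∀ j, z j ∈ Ω ∩ lat d (hk (φ j))) →
  ∀ z₀ ∈ frontier Ω, Tendsto z atTop (𝓝 z₀) →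
    liminf (fun j => u (z j)) atTop ≤ limsup (fun j => uh (hk (φ j)) (z j)) atTop

/-- `∂^i_h u_h(x)` for `i = 1, 2`. -/
def subdiffI (i : ℕ) (d : ℕ) (Ω : Set (Ed d)) (h : ℝ) (u : Ed d → ℝ) (x : Ed d) :
    Set (Ed d) :=
  if i = 1 then subdiff1 d Ω h u x else subdiff2 d Ω h u x

open Matrix in
/-- An integer matrix `A` with `AAᵀ` nonsingular can be completed by pairwise orthogonal integer
vectors in its kernel, whose lengths are controlled by the Gram determinant of the rows. -/
lemma exists_orthogonal_completion (d : ℕ) (T : ℤ) : ∀ (n : ℕ) (ι : Type) [Fintype ι]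
    [DecidableEq ι] (A : Matrix ι (Fin d) ℤ), Fintype.card ι + n = d → 0 < (A * Aᵀ).det →
    (A * Aᵀ).det ≤ T →
    ∃ b : Fin n → (Fin d → ℤ), (∀ j, b j ≠ 0) ∧ (∀ j, A *ᵥ b j = 0) ∧
      (∀ j k, j ≠ k → b j ⬝ᵥ b k = 0) ∧ ∀ j, b j ⬝ᵥ b j ≤ T ^ 2 := by
  intro n
  induction n with
  | zero =>
    intro ι _ _ A _ _ _
    exact ⟨fun j => j.elim0, fun j => j.elim0, fun j => j.elim0, fun j => j.elim0,
      fun j => j.elim0⟩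
  | succ n ih =>
    intro ι _ _ A hcard hpos hT
    set S := A * Aᵀ with hS
    set G := S.det with hG
    have hSt : Sᵀ = S := by rw [hS, transpose_mul, transpose_transpose]
    have hadjt : S.adjugateᵀ = S.adjugate := by rw [adjugate_transpose, hSt]
    set N : Matrix (Fin d) (Fin d) ℤ := G • (1 : Matrix (Fin d) (Fin d) ℤ) - Aᵀ * S.adjugate * A
      with hN
    have hAN : A * N = 0 := by
      rw [hN, Matrix.mul_sub, ← Matrix.mul_assoc, ← Matrix.mul_assoc, ← hS, mul_adjugate,
        Matrix.mul_smul, Matrix.mul_one, Matrix.smul_mul, Matrix.one_mul, hG, sub_self]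
    have hNt : Nᵀ = N := by
      rw [hN, transpose_sub, transpose_mul, transpose_mul, transpose_transpose, hadjt,
        Matrix.mul_assoc]
      simp
    have hNN : N * N = G • N := by
      nth_rewrite 1 [hN]
      rw [Matrix.sub_mul, Matrix.mul_assoc (Aᵀ * S.adjugate), hAN]
      simp
    have htr : N.trace = G * (n + 1) := by
      rw [hN, trace_sub, Matrix.mul_assoc, trace_mul_comm Aᵀ, Matrix.mul_assoc, ← hS, adjugate_mul]
      simp only [trace_smul, trace_one, Fintype.card_fin, smul_eq_mul]
      have : (d : ℤ) = Fintype.card ι + (n + 1) := by exact_mod_cast hcard.symm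
      rw [this, hG]; ring
    obtain ⟨i, hi⟩ : ∃ i, 0 < N i i := by
      by_contra! hcon
      have : N.trace ≤ 0 := Finset.sum_nonpos fun i _ => hcon i
      rw [htr] at this
      have : 0 < G * ((n : ℤ) + 1) := by positivity
      omega
    set b : Fin d → ℤ := N.col i with hb
    have hbb : b ⬝ᵥ b = G * N i i := by
      have h1 : (N * N) i i = G * N i i := by rw [hNN]; simp
      rw [← h1, mul_apply, dotProduct]
      refine Finset.sum_congr rfl fun j _ => ?_
      have : N i j = N j i := by conv_lhs => rw [← hNt, transpose_apply]
      rw [this]; rfl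
    have hNle : N i i ≤ G := by
      have h1 : N i i * N i i ≤ b ⬝ᵥ b :=
        Finset.single_le_sum (f := fun j => b j * b j) (fun j _ => mul_self_nonneg _)
          (Finset.mem_univ i)
      rw [hbb] at h1
      exact le_of_mul_le_mul_right h1 hi
    have hAb : A *ᵥ b = 0 := by
      funext j
      have := congrFun (congrFun hAN j) i
      rw [mul_apply] at this
      exact this
    have hbdot : ∀ v : Fin d → ℤ, A *ᵥ v = 0 → b ⬝ᵥ v = G * v i := by
      intro v hv
      have h1 : N *ᵥ v = G • v := by
        rw [hN, sub_mulVec, ← mulVec_mulVec, hv]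
        simp
      have h2 := congrFun h1 i
      simp only [Pi.smul_apply, smul_eq_mul] at h2
      rw [← h2, ← hNt]
      rfl
    set R : Matrix Unit (Fin d) ℤ := Matrix.of fun _ => Pi.single i 1 with hR
    set A' : Matrix (ι ⊕ Unit) (Fin d) ℤ := fromRows A R with hA'
    have hRRt : R * Rᵀ = 1 := by
      ext ⟨⟩ ⟨⟩
      simp [hR, mul_apply, Pi.single_apply]
    have hblock : A' * A'ᵀ = fromBlocks S (A * Rᵀ) (R * Aᵀ) 1 := by
      rw [hA', transpose_fromRows, fromRows_mul_fromCols, hRRt]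
    have hRNR : (R * N * Rᵀ) () () = N i i := by
      simp [hR, mul_apply, Pi.single_apply]
    have hdet : (A' * A'ᵀ).det = N i i := by
      have h1 : (A' * A'ᵀ) * fromBlocks 1 (-(S.adjugate * (A * Rᵀ))) 0 (G • (1 : Matrix Unit Unit ℤ))
          = fromBlocks S 0 (R * Aᵀ) (R * N * Rᵀ) := by
        rw [hblock, fromBlocks_multiply]
        congr 1
        · simp
        · rw [Matrix.mul_neg, ← Matrix.mul_assoc, mul_adjugate,
            Matrix.smul_mul, Matrix.mul_smul, Matrix.mul_one, Matrix.one_mul, hG, neg_add_cancel]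
        · simp
        · rw [hN]
          simp only [Matrix.mul_neg, Matrix.mul_sub, Matrix.sub_mul, Matrix.mul_assoc,
            Matrix.smul_mul, Matrix.mul_smul, Matrix.one_mul, hRRt]
          abel
      have h2 := congrArg det h1
      rw [det_mul, det_fromBlocks_zero₂₁, det_fromBlocks_zero₁₂] at h2
      simp only [det_one, one_mul] at h2
      rw [show (R * N * Rᵀ).det = N i i by rw [det_unique]; exact hRNR] at h2
      simp only [det_smul, Fintype.card_unique, pow_one, det_one, mul_one] at h2
      rw [← hG, mul_comm] at h2
      exact mul_left_cancel₀ hpos.ne' h2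
    obtain ⟨b', hb0, hbA, hborth, hbn⟩ := ih (ι ⊕ Unit) A' (by simp; omega)
      (by rw [hdet]; exact hi) (by rw [hdet]; exact hNle.trans hT)
    have hbA1 : ∀ j, A *ᵥ b' j = 0 := by
      intro j
      funext k
      have := congrFun (hbA j) (Sum.inl k)
      rw [hA', fromRows_mulVec] at this
      simpa using this
    have hbi : ∀ j, b' j i = 0 := by
      intro j
      have := congrFun (hbA j) (Sum.inr ())
      rw [hA', fromRows_mulVec] at this
      simpa [hR, mulVec] using this
    have hbb' : ∀ j, b ⬝ᵥ b' j = 0 := fun j => by rw [hbdot _ (hbA1 j), hbi j, mul_zero]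
    refine ⟨Fin.cons b b', ?_, ?_, ?_, ?_⟩
    · intro j
      refine Fin.cases ?_ (fun j => ?_) j
      · intro h0
        simp only [Fin.cons_zero] at h0
        rw [h0, zero_dotProduct] at hbb
        have : 0 < G * N i i := by positivity
        omega
      · simpa using hb0 j
    · intro j
      refine Fin.cases ?_ (fun j => ?_) j
      · simpa using hAb
      · simpa using hbA1 j
    · intro j k
      refine Fin.cases ?_ (fun j => ?_) j <;> refine Fin.cases ?_ (fun k => ?_) k
      · simp
      · intro _
        simpa using hbb' k
      · intro _
        simpa [dotProduct_comm] using hbb' j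
      · intro hjk
        simpa using hborth j k (fun h => hjk (by rw [h]))
    · intro j
      refine Fin.cases ?_ (fun j => ?_) j
      · simp only [Fin.cons_zero]
        rw [hbb]
        nlinarith
      · simpa using hbn j

/-- Simultaneous Diophantine approximation of an integer direction by Dirichlet's box principle. -/
lemma exists_int_multiple_near (d N : ℕ) (hN : 0 < N) (e : Fin d → ℤ) :
    ∃ r : ℤ, 1 ≤ r ∧ r < N ^ d + 1 ∧ ∃ c : Fin d → ℤ, ∀ i,
      N * |r * e i - (N ^ d + 1) * c i| ≤ (N ^ d + 1 : ℤ) := by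
  set J : ℕ := N ^ d + 1 with hJ
  have hJ0 : (0 : ℤ) < J := by positivity
  have hNz : (0 : ℤ) < N := by exact_mod_cast hN
  have hcell : ∀ z : ℤ, (N * (z % J) / J) < N := fun z => by
    rw [Int.ediv_lt_iff_lt_mul hJ0]
    exact mul_lt_mul_of_pos_left (Int.emod_lt_of_pos _ hJ0) hNz
  have hcell0 : ∀ z : ℤ, 0 ≤ (N * (z % J) / J) := fun z =>
    Int.ediv_nonneg (mul_nonneg hNz.le (Int.emod_nonneg _ hJ0.ne')) hJ0.le
  let F : Fin J → (Fin d → Fin N) := fun j i =>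
    ⟨(N * (((j : ℕ) : ℤ) * e i % J) / J).toNat, by
      have h1 := hcell (((j : ℕ) : ℤ) * e i)
      have h2 := hcell0 (((j : ℕ) : ℤ) * e i)
      omega⟩
  obtain ⟨j, j', hne, hF⟩ := Fintype.exists_ne_map_eq_of_card_lt F (by simp [hJ])
  wlog hlt : j < j' generalizing j j'
  · exact this j' j hne.symm hF.symm (lt_of_le_of_ne (not_lt.mp hlt) hne.symm)
  refine ⟨((j' : ℕ) : ℤ) - ((j : ℕ) : ℤ), ?_, ?_,
    fun i => ((j' : ℕ) : ℤ) * e i / J - ((j : ℕ) : ℤ) * e i / J, fun i => ?_⟩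
  · have : (j : ℕ) < j' := hlt
    omega
  · have := j'.2
    have h3 : ((j' : ℕ) : ℤ) < (J : ℤ) := by exact_mod_cast this
    have h4 : (J : ℤ) = N ^ d + 1 := by rw [hJ]; push_cast; ring
    omega
  · have h4 : ((N : ℤ) ^ d + 1) = J := by rw [hJ]; push_cast; ring
    rw [h4]
    set a := ((j : ℕ) : ℤ) * e i
    set b := ((j' : ℕ) : ℤ) * e i
    have hEq : N * (a % J) / J = N * (b % J) / J := by
      have h1 := congrArg Fin.val (congrFun hF i)
      have h2 := hcell0 a
      have h3 := hcell0 b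
      change (N * (a % J) / J).toNat = (N * (b % J) / J).toNat at h1
      omega
    have e1 := Int.emod_add_mul_ediv (N * (a % J)) J
    have e2 := Int.emod_add_mul_ediv (N * (b % J)) J
    have r1 := Int.emod_nonneg (N * (a % J)) hJ0.ne'
    have r2 := Int.emod_nonneg (N * (b % J)) hJ0.ne'
    have r3 := Int.emod_lt_of_pos (N * (a % J)) hJ0
    have r4 := Int.emod_lt_of_pos (N * (b % J)) hJ0
    have ha := Int.emod_add_mul_ediv a J
    have hb := Int.emod_add_mul_ediv b J
    have hx : (((j' : ℕ) : ℤ) - ((j : ℕ) : ℤ)) * e i - J * (b / J - a / J) = b % J - a % J := by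
      have : (((j' : ℕ) : ℤ) - ((j : ℕ) : ℤ)) * e i = b - a := by ring
      rw [this]; linarith
    rw [hx, show (N : ℤ) * |b % J - a % J| = |N * (b % J - a % J)| by
      rw [abs_mul, abs_of_pos hNz], mul_sub, abs_le]
    rw [← hEq] at e2
    constructor <;> linarith

lemma dotProduct_self_nonneg_int {d : ℕ} (v : Fin d → ℤ) : 0 ≤ v ⬝ᵥ v :=
  Finset.sum_nonneg fun _ _ => mul_self_nonneg _

lemma dotProduct_self_pos_int {d : ℕ} {v : Fin d → ℤ} (hv : v ≠ 0) : 0 < v ⬝ᵥ v :=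
  lt_of_le_of_ne (dotProduct_self_nonneg_int v) fun h => hv (dotProduct_self_eq_zero.mp h.symm)

set_option maxHeartbeats 1000000 in
/-- Every integer vector `e` is the first vector of an orthogonal integer basis whose other members
have length `o(|e|²)`. -/
lemma exists_short_orthogonal_completion (n : ℕ) (η : ℤ) (hη : 1 ≤ η) :
    ∃ C : ℤ, 0 ≤ C ∧ ∀ e : Fin (n + 1) → ℤ, e ≠ 0 → ∃ b : Fin n → (Fin (n + 1) → ℤ),
      (∀ j, b j ≠ 0) ∧ (∀ j, e ⬝ᵥ b j = 0) ∧ (∀ j k, j ≠ k → b j ⬝ᵥ b k = 0) ∧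
      ∀ j, η * (b j ⬝ᵥ b j) ≤ (e ⬝ᵥ e) ^ 2 + C := by
  rcases n with _ | n
  · exact ⟨0, le_rfl, fun e _ => ⟨fun j => j.elim0, fun j => j.elim0, fun j => j.elim0,
      fun j => j.elim0, fun j => j.elim0⟩⟩
  set d : ℕ := n + 1 + 1 with hd
  set N : ℕ := η.toNat * d with hN
  have hNη : (N : ℤ) = η * d := by rw [hN]; push_cast; rw [Int.toNat_of_nonneg (by omega)]
  have hd1 : (1 : ℤ) ≤ d := by rw [hd]; push_cast; omega
  have hN1 : (1 : ℤ) ≤ N := by rw [hNη]; nlinarith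
  have hN0 : 0 < N := by omega
  set J : ℤ := (N : ℤ) ^ d + 1 with hJ
  have hJ1 : 1 < J := by
    have : (0 : ℤ) < (N : ℤ) ^ d := by positivity
    omega
  set Q0 : ℤ := d * J ^ 2 with hQ0
  refine ⟨η * Q0 ^ 2, by positivity, ?_⟩
  suffices H : ∀ q : ℕ, ∀ e : Fin d → ℤ, e ≠ 0 → (e ⬝ᵥ e).toNat = q →
      ∃ b : Fin (n + 1) → (Fin d → ℤ),
      (∀ j, b j ≠ 0) ∧ (∀ j, e ⬝ᵥ b j = 0) ∧ (∀ j k, j ≠ k → b j ⬝ᵥ b k = 0) ∧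
      ∀ j, η * (b j ⬝ᵥ b j) ≤ (e ⬝ᵥ e) ^ 2 + η * Q0 ^ 2 from
    fun e he => H _ e he rfl
  intro q
  induction q using Nat.strong_induction_on with
  | _ q ih =>
  intro e he hq
  set Q : ℤ := e ⬝ᵥ e with hQ
  have hQpos : 0 < Q := dotProduct_self_pos_int he
  rcases le_or_gt Q Q0 with hsmall | hlarge
  · have hdet : (Matrix.of (fun _ : Unit => e) * (Matrix.of (fun _ : Unit => e)).transpose).det
        = Q := by
      rw [Matrix.det_unique, Matrix.mul_apply, hQ]; rfl
    obtain ⟨b, hb0, hbA, hbo, hbn⟩ := exists_orthogonal_completion d Q (n + 1) Unit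
      (Matrix.of fun _ => e) (by simp [hd]; omega) (by rw [hdet]; exact hQpos) hdet.le
    refine ⟨b, hb0, fun j => congrFun (hbA j) (), hbo, fun j => ?_⟩
    have h1 := hbn j
    have h2 : Q ^ 2 ≤ Q0 ^ 2 := by gcongr
    nlinarith [sq_nonneg Q]
  · obtain ⟨r, hr1, hrJ, c, hc⟩ := exists_int_multiple_near d N hN0 e
    rw [← hJ] at hrJ hc
    obtain ⟨i, hi⟩ : ∃ i, J ^ 2 < e i ^ 2 := by
      by_contra! hcon
      have : Q ≤ ∑ _i : Fin d, J ^ 2 := by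
        rw [hQ]
        exact Finset.sum_le_sum fun i _ => by simpa [sq] using hcon i
      simp only [Finset.sum_const, Finset.card_univ, Fintype.card_fin, nsmul_eq_mul] at this
      omega
    have hei : J < |e i| := by
      rw [← sq_abs (e i)] at hi
      exact lt_of_pow_lt_pow_left₀ 2 (abs_nonneg _) hi
    have hce : |r * e i - J * c i| ≤ J := by
      have h1 := hc i
      have h2 := abs_nonneg (r * e i - J * c i)
      nlinarith
    have hci0 : c ≠ 0 := by
      rintro rfl
      simp only [Pi.zero_apply, mul_zero, sub_zero, abs_mul, abs_of_pos (by omega : 0 < r)] at hce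
      nlinarith
    have hcc : 0 < c ⬝ᵥ c := dotProduct_self_pos_int hci0
    set G : ℤ := Q * (c ⬝ᵥ c) - (c ⬝ᵥ e) ^ 2 with hG
    set w : Fin d → ℤ := Q • c - (c ⬝ᵥ e) • e with hw
    have hww : w ⬝ᵥ w = Q * G := by
      rw [hw]
      simp only [dotProduct_sub, sub_dotProduct, smul_dotProduct, dotProduct_smul, smul_eq_mul]
      rw [dotProduct_comm e c, ← hQ, hG]; ring
    have hG0 : 0 ≤ G := by
      have := dotProduct_self_nonneg_int w
      rw [hww] at this
      exact nonneg_of_mul_nonneg_right this hQpos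
    have hew : e ⬝ᵥ w = 0 := by
      rw [hw]
      simp only [dotProduct_sub, dotProduct_smul, smul_eq_mul]
      rw [dotProduct_comm e c, ← hQ]; ring
    have hcw : c ⬝ᵥ w = G := by
      rw [hw]
      simp only [dotProduct_sub, dotProduct_smul, smul_eq_mul]
      rw [hG]; ring
    rcases hG0.eq_or_lt with hGz | hGpos
    · have hw0 : w = 0 := by
        apply dotProduct_self_eq_zero.mp
        rw [hww, ← hGz, mul_zero]
      have hpar : ∀ k, Q * c k = (c ⬝ᵥ e) * e k := fun k => by
        have := congrFun hw0 k
        simp only [hw, Pi.sub_apply, Pi.smul_apply, smul_eq_mul, Pi.zero_apply] at this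
        linarith
      have hce0 : c ⬝ᵥ e ≠ 0 := by
        intro h0
        have h1 : 0 < Q * (c ⬝ᵥ c) := by positivity
        have h2 : G = Q * (c ⬝ᵥ c) - 0 ^ 2 := by rw [hG, h0]
        linarith
      have hcei : |c i| < |e i| := by
        have h1 : J * |c i| ≤ r * |e i| + J := by
          have h2 : |J * c i| ≤ |r * e i| + |r * e i - J * c i| := by
            have := abs_sub_abs_le_abs_sub (J * c i) (r * e i)
            rw [abs_sub_comm] at this
            linarith
          rw [abs_mul, abs_mul, abs_of_pos (by omega : 0 < J), abs_of_pos (by omega : 0 < r)] at h2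
          linarith
        by_contra! hcon
        nlinarith
      have hcQ : c ⬝ᵥ c < Q := by
        have h1 : (c ⬝ᵥ c) * e i ^ 2 = c i ^ 2 * Q := by
          have h2 : (c ⬝ᵥ e) ^ 2 = Q * (c ⬝ᵥ c) := by omega
          have h3 : Q * (Q * c i ^ 2) = Q * ((c ⬝ᵥ c) * e i ^ 2) := by
            have := hpar i
            calc Q * (Q * c i ^ 2) = (Q * c i) ^ 2 := by ring
              _ = (c ⬝ᵥ e) ^ 2 * e i ^ 2 := by rw [this]; ring
              _ = _ := by rw [h2]; ring
          have := mul_left_cancel₀ hQpos.ne' h3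
          linarith
        have h4 : c i ^ 2 < e i ^ 2 := sq_lt_sq.mpr hcei
        by_contra! hcon
        nlinarith [sq_nonneg (c i)]
      obtain ⟨b, hb0, hbe, hbo, hbn⟩ := ih (c ⬝ᵥ c).toNat (by omega) c hci0 rfl
      refine ⟨b, hb0, fun j => ?_, hbo, fun j => (hbn j).trans ?_⟩
      · have h1 : w ⬝ᵥ b j = Q * (c ⬝ᵥ b j) - (c ⬝ᵥ e) * (e ⬝ᵥ b j) := by
          rw [hw]
          simp only [sub_dotProduct, smul_dotProduct, smul_eq_mul]
        rw [hw0, hbe j, zero_dotProduct] at h1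
        have : (c ⬝ᵥ e) * (e ⬝ᵥ b j) = 0 := by linarith
        exact (mul_eq_zero.mp this).resolve_left hce0
      · gcongr
    · have hGη : η * G ≤ Q := by
        set v : Fin d → ℤ := fun k => r * e k - J * c k with hv
        have hvv : (N : ℤ) ^ 2 * (v ⬝ᵥ v) ≤ d * J ^ 2 := by
          rw [dotProduct, Finset.mul_sum]
          calc ∑ k, (N : ℤ) ^ 2 * (v k * v k) ≤ ∑ _k : Fin d, J ^ 2 := by
                refine Finset.sum_le_sum fun k _ => ?_
                have h1 : (N : ℤ) ^ 2 * (v k * v k) = (N * |v k|) ^ 2 := by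
                  rw [mul_pow, sq_abs]; ring
                rw [h1]
                have h2 := hc k
                have h3 : (0 : ℤ) ≤ N * |v k| := by positivity
                gcongr
            _ = d * J ^ 2 := by simp
        have hcv : J ^ 2 * G = Q * (v ⬝ᵥ v) - (v ⬝ᵥ e) ^ 2 := by
          have : v = r • e - J • c := rfl
          rw [this]
          simp only [dotProduct_sub, sub_dotProduct, smul_dotProduct, dotProduct_smul, smul_eq_mul]
          rw [dotProduct_comm e c, ← hQ, hG]; ring
        have h1 : (N : ℤ) ^ 2 * (J ^ 2 * G) ≤ Q * (d * J ^ 2) := by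
          rw [hcv]
          have h2 := mul_nonneg (sq_nonneg (N : ℤ)) (sq_nonneg (v ⬝ᵥ e))
          have h3 := mul_le_mul_of_nonneg_left hvv hQpos.le
          linarith
        have h2 : (N : ℤ) ^ 2 * G ≤ Q * d := by
          have h3 : J ^ 2 * ((N : ℤ) ^ 2 * G) ≤ J ^ 2 * (Q * d) := by linarith
          exact le_of_mul_le_mul_left h3 (by positivity)
        rw [hNη] at h2
        have h3 : d * (η ^ 2 * d * G) ≤ d * Q := by linarith
        have h4 : η ^ 2 * d * G ≤ Q := le_of_mul_le_mul_left h3 (by omega)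
        have h5 : η * G ≤ η ^ 2 * d * G := by
          have : η ≤ η ^ 2 * d := by nlinarith
          gcongr
        exact h5.trans h4
      set A : Matrix (Fin 2) (Fin d) ℤ := Matrix.of ![e, c] with hA
      have hdet : (A * A.transpose).det = G := by
        rw [Matrix.det_fin_two]
        simp only [Matrix.mul_apply, Matrix.transpose_apply]
        change (e ⬝ᵥ e) * (c ⬝ᵥ c) - (e ⬝ᵥ c) * (c ⬝ᵥ e) = G
        rw [dotProduct_comm e c, hG, ← hQ]; ring
      obtain ⟨b, hb0, hbA, hbo, hbn⟩ := exists_orthogonal_completion d G n (Fin 2) A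
        (by simp [hd]; omega) (by rw [hdet]; exact hGpos) hdet.le
      have hbe : ∀ j, e ⬝ᵥ b j = 0 := fun j => congrFun (hbA j) 0
      have hbc : ∀ j, c ⬝ᵥ b j = 0 := fun j => congrFun (hbA j) 1
      have hbw : ∀ j, w ⬝ᵥ b j = 0 := fun j => by
        rw [hw]
        simp only [sub_dotProduct, smul_dotProduct, smul_eq_mul, hbe j, hbc j]
        ring
      have hw0 : w ≠ 0 := by
        intro h0
        rw [h0, dotProduct_zero] at hcw
        omega
      have hC0 : 0 ≤ η * Q0 ^ 2 := by positivity
      refine ⟨Fin.cons w b, ?_, ?_, ?_, ?_⟩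
      · intro j
        refine Fin.cases ?_ (fun j => ?_) j
        · simpa using hw0
        · simpa using hb0 j
      · intro j
        refine Fin.cases ?_ (fun j => ?_) j
        · simpa using hew
        · simpa using hbe j
      · intro j k
        refine Fin.cases ?_ (fun j => ?_) j <;> refine Fin.cases ?_ (fun k => ?_) k
        · simp
        · intro _
          simpa using hbw k
        · intro _
          simpa [dotProduct_comm] using hbw j
        · intro hjk
          simpa using hbo j k (fun h => hjk (by rw [h]))
      · intro j
        refine Fin.cases ?_ (fun j => ?_) j
        · simp only [Fin.cons_zero]
          rw [hww]
          nlinarith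
        · simp only [Fin.cons_succ]
          have h1 := hbn j
          have h2 : η * G ^ 2 ≤ (η * G) ^ 2 := by
            have : η ≤ η ^ 2 := by nlinarith
            rw [mul_pow]; gcongr
          have h3 : (η * G) ^ 2 ≤ Q ^ 2 := by gcongr
          nlinarith

/-- The lattice vector with integer coordinates `m`. -/
def latVec {d : ℕ} (h : ℝ) (m : Fin d → ℤ) : Ed d := WithLp.toLp 2 fun i => (m i : ℝ) * h

lemma latVec_apply {d : ℕ} (h : ℝ) (m : Fin d → ℤ) (i : Fin d) : latVec h m i = (m i : ℝ) * h := rfl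

lemma latVec_mem {d : ℕ} (h : ℝ) (m : Fin d → ℤ) : latVec h m ∈ lat d h := ⟨m, fun _ => rfl⟩

lemma mem_lat_iff {d : ℕ} {h : ℝ} {x : Ed d} : x ∈ lat d h ↔ ∃ m, x = latVec h m := by
  constructor
  · rintro ⟨m, hm⟩
    exact ⟨m, by ext i; exact hm i⟩
  · rintro ⟨m, rfl⟩
    exact latVec_mem h m

lemma inner_latVec {d : ℕ} (h : ℝ) (m n : Fin d → ℤ) :
    ⟪latVec h m, latVec h n⟫ = h ^ 2 * ((m ⬝ᵥ n : ℤ) : ℝ) := by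
  simp only [PiLp.inner_apply, latVec_apply, dotProduct, Int.cast_sum, Int.cast_mul,
    Finset.mul_sum]
  refine Finset.sum_congr rfl fun i _ => ?_
  simp; ring

lemma lat_add {d : ℕ} {h : ℝ} {x y : Ed d} (hx : x ∈ lat d h) (hy : y ∈ lat d h) :
    x + y ∈ lat d h := by
  obtain ⟨m, hm⟩ := hx
  obtain ⟨n, hn⟩ := hy
  exact ⟨m + n, fun i => by simp [hm i, hn i, add_mul]⟩

lemma lat_sub {d : ℕ} {h : ℝ} {x y : Ed d} (hx : x ∈ lat d h) (hy : y ∈ lat d h) :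
    x - y ∈ lat d h := by
  obtain ⟨m, hm⟩ := hx
  obtain ⟨n, hn⟩ := hy
  exact ⟨m - n, fun i => by simp [hm i, hn i, sub_mul]⟩

lemma lat_nsmul {d : ℕ} {h : ℝ} {x : Ed d} (hx : x ∈ lat d h) (k : ℕ) :
    (k : ℝ) • x ∈ lat d h := by
  obtain ⟨m, hm⟩ := hx
  exact ⟨k • m, fun i => by simp [hm i, mul_assoc]⟩

lemma lat_single {d : ℕ} (h : ℝ) (i : Fin d) : h • EuclideanSpace.single i (1 : ℝ) ∈ lat d h :=
  ⟨Pi.single i 1, fun j => by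
    by_cases hij : j = i
    · subst hij; simp
    · simp [hij]⟩

lemma norm_le_card_mul {d : ℕ} {v : Ed d} {r : ℝ} (hv : ∀ i, |v i| ≤ r) : ‖v‖ ≤ d * r := by
  calc ‖v‖ ≤ ∑ i, |v i| := by
        rw [EuclideanSpace.norm_eq]
        refine Real.sqrt_le_iff.mpr ⟨Finset.sum_nonneg fun i _ => abs_nonneg _, ?_⟩
        exact Finset.sum_sq_le_sq_sum_of_nonneg fun i _ => abs_nonneg _
    _ ≤ ∑ _i : Fin d, r := Finset.sum_le_sum fun i _ => hv i
    _ = d * r := by simp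

/-- Every point is within distance `d * h` of the lattice. -/
lemma exists_lat_near {d : ℕ} {h : ℝ} (hh : 0 < h) (x : Ed d) :
    ∃ y ∈ lat d h, ‖y - x‖ ≤ d * h := by
  refine ⟨latVec h fun i => ⌊x i / h⌋, latVec_mem _ _, norm_le_card_mul fun i => ?_⟩
  rw [PiLp.sub_apply, latVec_apply]
  have h1 := Int.floor_le (x i / h)
  have h2 := Int.lt_floor_add_one (x i / h)
  rw [le_div_iff₀ hh] at h1
  rw [div_lt_iff₀ hh] at h2
  rw [abs_le]
  constructor <;> linarith

lemma lat_inter_finite {d : ℕ} {h : ℝ} (hh : 0 < h) {S : Set (Ed d)}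
    (hS : Bornology.IsBounded S) : (S ∩ lat d h).Finite := by
  obtain ⟨R, hR⟩ := hS.exists_norm_le
  set n : ℤ := ⌈R / h⌉ with hn
  refine Set.Finite.subset ((Set.Finite.pi' fun _ : Fin d => Set.finite_Icc (-n) n).image
    (latVec h)) ?_
  rintro x ⟨hxS, hx⟩
  obtain ⟨m, rfl⟩ := mem_lat_iff.mp hx
  refine ⟨m, fun i => ?_, rfl⟩
  have h1 : |(m i : ℝ) * h| ≤ R := (PiLp.norm_apply_le (latVec h m) i).trans (hR _ hxS)
  rw [abs_mul, abs_of_pos hh, ← le_div_iff₀ hh] at h1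
  have h2 : |(m i : ℝ)| ≤ n := h1.trans (Int.le_ceil _)
  have h3 : |m i| ≤ n := by exact_mod_cast h2
  exact abs_le.mp h3

lemma norm_smul_single {d : ℕ} {h : ℝ} (hh : 0 < h) (i : Fin d) :
    ‖h • EuclideanSpace.single i (1 : ℝ)‖ = h := by
  rw [norm_smul, PiLp.norm_single]; simp [abs_of_pos hh]

lemma mem_meshInt_of_closedBall {d : ℕ} {Ω : Set (Ed d)} {h ρ : ℝ} (hh : 0 < h) (hρ : h ≤ ρ)
    {x : Ed d} (hx : x ∈ lat d h) (hb : Metric.closedBall x ρ ⊆ Ω) : x ∈ meshInt d Ω h := by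
  refine ⟨⟨hb (Metric.mem_closedBall_self (hh.le.trans hρ)), hx⟩, fun i => ⟨⟨subset_closure (hb ?_),
    lat_add hx (lat_single h i)⟩, ⟨subset_closure (hb ?_), lat_sub hx (lat_single h i)⟩⟩⟩
  · rw [mem_closedBall_iff_norm, add_sub_cancel_left, norm_smul_single hh]; exact hρ
  · rw [mem_closedBall_iff_norm, sub_sub_cancel_left, norm_neg, norm_smul_single hh]; exact hρ

/-- Short lattice vectors belong to admissible orthogonal bases at points away from the boundary. -/
lemma exists_admB_of_short {d : ℕ} (M ρ : ℝ) (hM : 0 < M) (hρ : 0 < ρ) :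
    ∃ h₀ > 0, ∀ h, 0 < h → h < h₀ → ∀ (Ω : Set (Ed d)) (x : Ed d), x ∈ lat d h →
      Metric.closedBall x ρ ⊆ Ω → ∀ e ∈ lat d h, e ≠ 0 → ‖e‖ ≤ M * √h →
      ∃ b : Fin d → Ed d, admB d Ω h x b ∧ ∃ i, b i = e := by
  rcases d with _ | n
  · exact ⟨1, one_pos, fun h _ _ Ω x _ _ e _ he => absurd (Subsingleton.elim e 0) he⟩
  set η : ℤ := max 1 ⌈(M ^ 4 + 1) / ρ ^ 2⌉ with hη
  obtain ⟨C, hC0, hC⟩ := exists_short_orthogonal_completion n η (le_max_left _ _)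
  have hη1 : (1 : ℝ) ≤ η := by exact_mod_cast le_max_left _ _
  have hη2 : M ^ 4 + 1 ≤ η * ρ ^ 2 := by
    rw [← div_le_iff₀ (by positivity)]
    exact (Int.le_ceil _).trans (by exact_mod_cast le_max_right _ _)
  have hC0' : (0 : ℝ) ≤ C := by exact_mod_cast hC0
  refine ⟨min (1 / (C + 1)) (min 1 (ρ ^ 2 / M ^ 2)), by positivity, ?_⟩
  intro h hh hh0 Ω x hx hb e he he0 hen
  have hh1 : h < 1 / (C + 1) := hh0.trans_le (min_le_left _ _)
  have hh2 : h < 1 := hh0.trans_le ((min_le_right _ _).trans (min_le_left _ _))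
  have hh3 : h < ρ ^ 2 / M ^ 2 := hh0.trans_le ((min_le_right _ _).trans (min_le_right _ _))
  obtain ⟨m, rfl⟩ := mem_lat_iff.mp he
  have hm0 : m ≠ 0 := by
    rintro rfl
    exact he0 (by ext i; simp [latVec_apply])
  obtain ⟨b, hb0, hbe, hbo, hbn⟩ := hC m hm0
  have hsq : h ^ 2 * ((m ⬝ᵥ m : ℤ) : ℝ) ≤ M ^ 2 * h := by
    rw [← inner_latVec, real_inner_self_eq_norm_sq]
    calc ‖latVec h m‖ ^ 2 ≤ (M * √h) ^ 2 := by gcongr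
      _ = M ^ 2 * h := by rw [mul_pow, Real.sq_sqrt hh.le]
  have hnorm : ∀ k, ‖latVec h (b k)‖ ≤ ρ := by
    intro k
    have h1 : (η : ℝ) * ((b k ⬝ᵥ b k : ℤ) : ℝ) ≤ ((m ⬝ᵥ m : ℤ) : ℝ) ^ 2 + C := by
      exact_mod_cast hbn k
    have h2 : ‖latVec h (b k)‖ ^ 2 ≤ ρ ^ 2 := by
      rw [← real_inner_self_eq_norm_sq, inner_latVec]
      set B : ℝ := ((b k ⬝ᵥ b k : ℤ) : ℝ)
      set Q : ℝ := ((m ⬝ᵥ m : ℤ) : ℝ)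
      have hQ0 : 0 ≤ h * Q := by
        have : (0 : ℝ) ≤ Q := Int.cast_nonneg (dotProduct_self_nonneg_int m)
        positivity
      have h3 : h * Q ≤ M ^ 2 := by
        have : h * (h * Q) ≤ h * M ^ 2 := by linarith
        exact le_of_mul_le_mul_left this hh
      have h4 : (h * Q) ^ 2 ≤ (M ^ 2) ^ 2 := by gcongr
      have h5 : h ^ 2 * C ≤ 1 := by
        rw [lt_div_iff₀ (by positivity)] at hh1
        nlinarith
      have h6 : η * (h ^ 2 * B) ≤ η * ρ ^ 2 := by
        calc η * (h ^ 2 * B) = h ^ 2 * (η * B) := by ring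
          _ ≤ h ^ 2 * (Q ^ 2 + C) := by gcongr
          _ ≤ M ^ 4 + 1 := by nlinarith
          _ ≤ _ := hη2
      exact le_of_mul_le_mul_left h6 (by linarith)
    exact le_of_sq_le_sq h2 hρ.le
  have hnorm0 : ‖latVec h m‖ ≤ ρ := by
    refine le_of_sq_le_sq ?_ hρ.le
    rw [← real_inner_self_eq_norm_sq, inner_latVec]
    rw [lt_div_iff₀ (by positivity)] at hh3
    linarith
  have hne : ∀ v : Fin (n + 1) → ℤ, v ≠ 0 → latVec h v ≠ 0 := by
    intro v hv h0
    apply hv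
    funext i
    have := congrArg (fun w : Ed (n + 1) => w i) h0
    simp only [latVec_apply, PiLp.zero_apply, mul_eq_zero, hh.ne', or_false] at this
    exact_mod_cast this
  set V : Fin (n + 1) → Fin (n + 1) → ℤ := Fin.cons m b with hV
  have hVn : ∀ i, ‖latVec h (V i)‖ ≤ ρ := fun i => by
    refine Fin.cases ?_ (fun j => ?_) i
    · simpa [hV] using hnorm0
    · simpa [hV] using hnorm j
  refine ⟨fun i => latVec h (V i), ⟨fun i => latVec_mem _ _, fun i => hne _ ?_, ?_, fun i => ?_,
    fun i => ?_⟩, 0, by simp [hV]⟩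
  · refine Fin.cases ?_ (fun j => ?_) i
    · simpa [hV] using hm0
    · simpa [hV] using hb0 j
  · intro i j hij
    rw [inner_latVec]
    have : V i ⬝ᵥ V j = 0 := by
      revert hij
      refine Fin.cases ?_ (fun i => ?_) i <;> refine Fin.cases ?_ (fun j => ?_) j
      · simp
      · intro _; simpa [hV] using hbe j
      · intro _; simpa [hV, dotProduct_comm] using hbe i
      · intro hij
        simpa [hV] using hbo i j (fun h => hij (by rw [h]))
    rw [this]; simp
  · refine ⟨subset_closure (hb ?_), lat_add hx (latVec_mem _ _)⟩
    rw [mem_closedBall_iff_norm, add_sub_cancel_left]; exact hVn i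
  · refine ⟨subset_closure (hb ?_), lat_sub hx (latVec_mem _ _)⟩
    rw [mem_closedBall_iff_norm, sub_sub_cancel_left, norm_neg]; exact hVn i

lemma subdiff2_subset_subdiff1 {d : ℕ} {Ω : Set (Ed d)} {h : ℝ} {u : Ed d → ℝ} {x : Ed d} :
    subdiff2 d Ω h u x ⊆ subdiff1 d Ω h u x := by
  rintro p hp e ⟨he, -, -, h1, h2⟩ i
  exact hp (e i) (he i) (h1 i) (h2 i)

lemma subdiffI_subset_subdiff1 {i d : ℕ} {Ω : Set (Ed d)} {h : ℝ} {u : Ed d → ℝ} {x : Ed d} :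
    subdiffI i d Ω h u x ⊆ subdiff1 d Ω h u x := by
  unfold subdiffI
  split_ifs
  · exact subset_rfl
  · exact subdiff2_subset_subdiff1

/-- A global mesh subgradient lies in both discrete normal mappings. -/
lemma mem_subdiffI_of_forall {i d : ℕ} {Ω : Set (Ed d)} {h : ℝ} {u : Ed d → ℝ} {x p : Ed d}
    (hp : ∀ y ∈ closure Ω ∩ lat d h, u x + ⟪p, y - x⟫ ≤ u y) : p ∈ subdiffI i d Ω h u x := by
  have h2 : p ∈ subdiff2 d Ω h u x := by
    intro e _ h1 h2
    have a1 := hp _ h1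
    have a2 := hp _ h2
    rw [add_sub_cancel_left] at a1
    rw [sub_sub_cancel_left, inner_neg_right] at a2
    constructor <;> linarith
  unfold subdiffI
  split_ifs
  · exact subdiff2_subset_subdiff1 h2
  · exact h2

lemma isClosed_subdiffI {i d : ℕ} {Ω : Set (Ed d)} {h : ℝ} {u : Ed d → ℝ} {x : Ed d} :
    IsClosed (subdiffI i d Ω h u x) := by
  have key : ∀ e : Ed d, ∀ a b : ℝ, IsClosed {p : Ed d | a ≤ ⟪p, e⟫ ∧ ⟪p, e⟫ ≤ b} := fun e a b => by
    have hc : Continuous fun p : Ed d => ⟪p, e⟫ := by fun_prop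
    exact (isClosed_le continuous_const hc).inter (isClosed_le hc continuous_const)
  unfold subdiffI
  split_ifs
  · simp only [subdiff1, Set.ofPred_forall]
    exact isClosed_iInter fun e => isClosed_iInter fun _ => isClosed_iInter fun i => key _ _ _
  · simp only [subdiff2, Set.ofPred_forall]
    exact isClosed_iInter fun e => isClosed_iInter fun _ => isClosed_iInter fun _ =>
      isClosed_iInter fun _ => key _ _ _

/-- Along a lattice line, a discrete convex function lies above its first difference. -/
lemma DiscConvex.le_of_chain {d : ℕ} {Ω : Set (Ed d)} {h : ℝ} {u : Ed d → ℝ}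
    (hu : DiscConvex d Ω h u) {x e : Ed d} (hx : x ∈ closure Ω ∩ lat d h) (he : e ∈ lat d h)
    {k : ℕ} (hmid : ∀ j : ℕ, 0 < j → j < k → x + (j : ℝ) • e ∈ meshInt d Ω h)
    (hend : x + (k : ℝ) • e ∈ closure Ω) :
    u x + k * (u (x + e) - u x) ≤ u (x + (k : ℝ) • e) := by
  have hcl : ∀ j : ℕ, j ≤ k → x + (j : ℝ) • e ∈ closure Ω ∩ lat d h := by
    intro j hj
    refine ⟨?_, lat_add hx.2 (lat_nsmul he j)⟩
    rcases Nat.eq_zero_or_pos j with rfl | hj0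
    · simpa using hx.1
    rcases hj.eq_or_lt with rfl | hjk
    · exact hend
    · exact subset_closure (hmid j hj0 hjk).1.1
  have hdiff : ∀ j : ℕ, j < k →
      u (x + e) - u x ≤ u (x + ((j + 1 : ℕ) : ℝ) • e) - u (x + (j : ℝ) • e) := by
    intro j
    induction j with
    | zero => intro _; simp
    | succ j ih =>
      intro hj
      refine (ih (by omega)).trans ?_
      have e1 : x + ((j + 1 : ℕ) : ℝ) • e + e = x + ((j + 1 + 1 : ℕ) : ℝ) • e := by
        push_cast; module
      have e2 : x + ((j + 1 : ℕ) : ℝ) • e - e = x + (j : ℝ) • e := by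
        push_cast; module
      have := hu _ (hmid (j + 1) (by omega) hj) e he (by rw [e1]; exact hcl _ (by omega))
        (by rw [e2]; exact hcl _ (by omega))
      rw [e1, e2] at this
      linarith
  have hsum : ∀ j : ℕ, j ≤ k → u x + j * (u (x + e) - u x) ≤ u (x + (j : ℝ) • e) := by
    intro j
    induction j with
    | zero => intro _; simp
    | succ j ih =>
      intro hj
      have h1 := ih (by omega)
      have h2 := hdiff j (by omega)
      push_cast at h2 ⊢
      linarith
  exact hsum k le_rfl

/-- `u` solves the discrete Monge–Ampère problem on the mesh of size `h` with right-hand side `f`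
of total mass at most `A` and boundary values `g`. -/
structure MeshSol (i d : ℕ) (Ω : Set (Ed d)) (g : Ed d → ℝ) (A h : ℝ) (f u : Ed d → ℝ) : Prop where
  conv : DiscConvex d Ω h u
  nonneg : ∀ x ∈ meshInt d Ω h, 0 ≤ f x
  eq : ∀ x ∈ meshInt d Ω h, volume (subdiffI i d Ω h u x) = ENNReal.ofReal (h ^ d * f x)
  bc : ∀ x ∈ (closure Ω ∩ lat d h) \ meshInt d Ω h, u x = g x
  mass : h ^ d * ∑' x : meshInt d Ω h, f x ≤ A

lemma meshInt_subset {d : ℕ} {Ω : Set (Ed d)} {h : ℝ} :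
    meshInt d Ω h ⊆ closure Ω ∩ lat d h := fun _ hx => ⟨subset_closure hx.1.1, hx.1.2⟩

lemma inter_meshInt_finite {d : ℕ} {Ω : Set (Ed d)} (hb : Bornology.IsBounded Ω) {h : ℝ}
    (hh : 0 < h) (V : Set (Ed d)) : (V ∩ meshInt d Ω h).Finite :=
  (lat_inter_finite hh hb.closure).subset (Set.inter_subset_right.trans meshInt_subset)

lemma MeshSol.sum_volume {i d : ℕ} {Ω : Set (Ed d)} {g : Ed d → ℝ} {A h : ℝ} {f u : Ed d → ℝ}
    (hs : MeshSol i d Ω g A h f u) (hb : Bornology.IsBounded Ω) (hh : 0 < h) (V : Set (Ed d)) :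
    ∑ x ∈ (inter_meshInt_finite hb hh V).toFinset, volume (subdiffI i d Ω h u x) =
      ENNReal.ofReal (h ^ d * ∑' x : (V ∩ meshInt d Ω h : Set (Ed d)), f x) := by
  set F := (inter_meshInt_finite hb hh V).toFinset with hF
  have h1 : ∑' x : (V ∩ meshInt d Ω h : Set (Ed d)), f x = ∑ x ∈ F, f x := by
    rw [← Finset.tsum_subtype' F f]
    have : (V ∩ meshInt d Ω h : Set (Ed d)) = (F : Set (Ed d)) := by simp [hF]
    rw [this]
  have hmem : ∀ x ∈ F, x ∈ meshInt d Ω h := fun x hx => by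
    rw [hF, Set.Finite.mem_toFinset] at hx
    exact hx.2
  rw [h1, Finset.mul_sum, ENNReal.ofReal_sum_of_nonneg fun x hx =>
    mul_nonneg (by positivity) (hs.nonneg x (hmem x hx))]
  exact Finset.sum_congr rfl fun x hx => hs.eq x (hmem x hx)

lemma MeshSol.volume_biUnion_le {i d : ℕ} {Ω : Set (Ed d)} {g : Ed d → ℝ} {A h : ℝ}
    {f u : Ed d → ℝ} (hs : MeshSol i d Ω g A h f u) (hb : Bornology.IsBounded Ω) (hh : 0 < h)
    (V : Set (Ed d)) :
    volume (⋃ x ∈ V ∩ meshInt d Ω h, subdiffI i d Ω h u x) ≤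
      ENNReal.ofReal (h ^ d * ∑' x : (V ∩ meshInt d Ω h : Set (Ed d)), f x) := by
  rw [← hs.sum_volume hb hh V]
  refine le_trans (measure_mono ?_) (measure_biUnion_finset_le _ _)
  intro p hp
  simpa using hp

lemma MeshSol.volume_biUnion_le_mass {i d : ℕ} {Ω : Set (Ed d)} {g : Ed d → ℝ} {A h : ℝ}
    {f u : Ed d → ℝ} (hs : MeshSol i d Ω g A h f u) (hb : Bornology.IsBounded Ω) (hh : 0 < h) :
    volume (⋃ x ∈ meshInt d Ω h, subdiffI i d Ω h u x) ≤ ENNReal.ofReal A := by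
  have h1 := hs.volume_biUnion_le hb hh Set.univ
  have h2 : (Set.univ ∩ meshInt d Ω h : Set (Ed d)) = meshInt d Ω h := Set.univ_inter _
  rw [h2] at h1
  exact h1.trans (ENNReal.ofReal_le_ofReal hs.mass)

lemma exists_unit_outer_normal {d : ℕ} {Ω : Set (Ed d)} (ho : IsOpen Ω) (hc : Convex ℝ Ω)
    {x₀ : Ed d} (hx₀ : x₀ ∈ frontier Ω) :
    ∃ n : Ed d, ‖n‖ = 1 ∧ ∀ y ∈ closure Ω, 0 ≤ ⟪n, x₀ - y⟫ := by
  have hx : x₀ ∉ Ω := by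
    rw [ho.frontier_eq] at hx₀
    exact hx₀.2
  obtain ⟨φ, hφ⟩ := geometric_hahn_banach_open_point hc ho hx
  have hne : Ω.Nonempty := closure_nonempty_iff.mp ⟨x₀, frontier_subset_closure hx₀⟩
  set w := (InnerProductSpace.toDual ℝ (Ed d)).symm φ with hw
  have hφw : ∀ y, φ y = ⟪w, y⟫ := fun y => by
    rw [hw, InnerProductSpace.toDual_symm_apply]
  have hw0 : w ≠ 0 := by
    intro h0
    obtain ⟨a, ha⟩ := hne
    have := hφ a ha
    simp [hφw, h0] at this
  have hwn : 0 < ‖w‖ := norm_pos_iff.mpr hw0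
  have hcl : ∀ y ∈ closure Ω, 0 ≤ ⟪w, x₀ - y⟫ := by
    intro y hy
    have hcl : IsClosed {y : Ed d | 0 ≤ ⟪w, x₀ - y⟫} :=
      isClosed_le continuous_const (by fun_prop)
    refine closure_minimal (fun a ha => ?_) hcl hy
    have := hφ a ha
    rw [hφw, hφw] at this
    change 0 ≤ ⟪w, x₀ - a⟫
    rw [inner_sub_right]; linarith
  refine ⟨‖w‖⁻¹ • w, by rw [norm_smul, norm_inv, norm_norm, inv_mul_cancel₀ hwn.ne'],
    fun y hy => ?_⟩
  rw [real_inner_smul_left]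
  exact mul_nonneg (by positivity) (hcl y hy)

/-- Discrete comparison with a function with negative discrete Laplacian. -/
lemma MeshSol.le_of_supersolution {i d : ℕ} {Ω : Set (Ed d)} {g : Ed d → ℝ} {A h : ℝ}
    {f u : Ed d → ℝ} (hs : MeshSol i d Ω g A h f u) (hb : Bornology.IsBounded Ω) (hh : 0 < h)
    {B : Ed d → ℝ} (hB : ∀ y ∈ closure Ω, g y ≤ B y)
    (hlap : ∀ y : Ed d, ∑ k : Fin d, (B (y + h • EuclideanSpace.single k (1 : ℝ)) - 2 * B y +
      B (y - h • EuclideanSpace.single k (1 : ℝ))) < 0) :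
    ∀ x ∈ closure Ω ∩ lat d h, u x ≤ B x := by
  intro x hx
  obtain ⟨y, hy, hmax⟩ := (lat_inter_finite hh hb.closure).toFinset.exists_max_image
    (fun y => u y - B y) ⟨x, by simpa using hx⟩
  rw [Set.Finite.mem_toFinset] at hy
  have hmax' : ∀ z ∈ closure Ω ∩ lat d h, u z - B z ≤ u y - B y := fun z hz =>
    hmax z ((Set.Finite.mem_toFinset _).mpr hz)
  have hxy := hmax' x hx
  by_cases hyi : y ∈ meshInt d Ω h
  · exfalso
    have h1 := hlap y
    refine absurd h1 (not_lt.mpr (Finset.sum_nonneg fun k _ => ?_))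
    have h2 := hs.conv y hyi _ (lat_single h k) (hyi.2 k).1 (hyi.2 k).2
    have h3 := hmax' _ (hyi.2 k).1
    have h4 := hmax' _ (hyi.2 k).2
    linarith
  · have h1 := hs.bc y ⟨hy, hyi⟩
    have h2 := hB y hy.1
    linarith

/-- Upper barrier at a boundary point. -/
lemma exists_upper_barrier {d : ℕ} (hd : 0 < d) {Ω : Set (Ed d)} (ho : IsOpen Ω)
    (hc : Convex ℝ Ω) (hb : Bornology.IsBounded Ω) {g : Ed d → ℝ}
    (hg : ContinuousOn g (closure Ω)) {x₀ : Ed d} (hx₀ : x₀ ∈ frontier Ω) {ε : ℝ} (hε : 0 < ε) :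
    ∃ B : Ed d → ℝ, Continuous B ∧ B x₀ = g x₀ + ε ∧ ∀ (i : ℕ) (A h : ℝ) (f u : Ed d → ℝ), 0 < h →
      MeshSol i d Ω g A h f u → ∀ x ∈ closure Ω ∩ lat d h, u x ≤ B x := by
  obtain ⟨n, hn, hnt⟩ := exists_unit_outer_normal ho hc hx₀
  have hx₀c := frontier_subset_closure hx₀
  have hcomp : IsCompact (closure Ω) := hb.isCompact_closure
  obtain ⟨Gm, hGm⟩ := hcomp.exists_bound_of_continuousOn hg
  obtain ⟨δ, hδ, hgδ⟩ := Metric.continuousWithinAt_iff.mp (hg x₀ hx₀c) ε hε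
  set D := Metric.diam (closure Ω) with hD
  have hdist : ∀ y ∈ closure Ω, ‖y - x₀‖ ≤ D := fun y hy => by
    rw [← dist_eq_norm]
    exact Metric.dist_le_diam_of_mem hb.closure hy hx₀c
  set C : ℝ := 2 * Gm / δ ^ 2 + 1 with hC
  have hGm0 : 0 ≤ Gm := (norm_nonneg _).trans (hGm x₀ hx₀c)
  have hCpos : 0 < C := by positivity
  set t : Ed d → ℝ := fun y => ⟪n, x₀ - y⟫ with ht
  refine ⟨fun y => g x₀ + ε + C * (‖y - x₀‖ ^ 2 + ((d + 1) * D) * t y - (d + 1) * t y ^ 2),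
    by fun_prop, by simp [ht], ?_⟩
  intro i A h f u hh hs
  refine hs.le_of_supersolution hb hh (fun y hy => ?_) (fun y => ?_)
  · have ht0 : 0 ≤ t y := hnt y hy
    have htD : t y ≤ D := by
      calc t y ≤ ‖n‖ * ‖x₀ - y‖ := real_inner_le_norm _ _
        _ = ‖y - x₀‖ := by rw [hn, one_mul, norm_sub_rev]
        _ ≤ D := hdist y hy
    have h1 : 0 ≤ ((d + 1) * D) * t y - (d + 1) * t y ^ 2 := by
      have : ((d + 1) * D) * t y - (d + 1) * t y ^ 2 = (d + 1) * (t y * (D - t y)) := by ring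
      rw [this]
      have : 0 ≤ D - t y := by linarith
      positivity
    by_cases hyδ : dist y x₀ < δ
    · have h2 := hgδ hy hyδ
      rw [Real.dist_eq] at h2
      have h3 := (abs_lt.mp h2).2
      have h4 : 0 ≤ C * (‖y - x₀‖ ^ 2 + ((d + 1) * D) * t y - (d + 1) * t y ^ 2) := by
        have := sq_nonneg ‖y - x₀‖
        apply mul_nonneg hCpos.le; linarith
      linarith
    · rw [dist_eq_norm] at hyδ
      have h2 : δ ^ 2 ≤ ‖y - x₀‖ ^ 2 := by gcongr; linarith
      have h3 : C * δ ^ 2 ≤ C * (‖y - x₀‖ ^ 2 + ((d + 1) * D) * t y - (d + 1) * t y ^ 2) := by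
        gcongr; linarith
      have h4 : 2 * Gm ≤ C * δ ^ 2 := by
        rw [hC, add_mul, div_mul_cancel₀ _ (by positivity)]
        nlinarith [sq_nonneg δ]
      have h5 := (abs_le.mp (hGm y hy)).2
      have h6 := (abs_le.mp (hGm x₀ hx₀c)).1
      linarith
  · have hpt : ∀ k : Fin d, ∀ v : Ed d, v = h • EuclideanSpace.single k (1 : ℝ) →
        (g x₀ + ε + C * (‖y + v - x₀‖ ^ 2 + ((d + 1) * D) * t (y + v) - (d + 1) * t (y + v) ^ 2))
        - 2 * (g x₀ + ε + C * (‖y - x₀‖ ^ 2 + ((d + 1) * D) * t y - (d + 1) * t y ^ 2))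
        + (g x₀ + ε + C * (‖y - v - x₀‖ ^ 2 + ((d + 1) * D) * t (y - v)
          - (d + 1) * t (y - v) ^ 2)) = C * h ^ 2 * (2 - 2 * (d + 1) * n k ^ 2) := by
      intro k v hv
      have a1 : t (y + v) = t y - ⟪n, v⟫ := by
        simp only [ht]; rw [← inner_sub_right]; congr 1; abel
      have a2 : t (y - v) = t y + ⟪n, v⟫ := by
        simp only [ht]; rw [← inner_add_right]; congr 1; abel
      have a3 : ‖y + v - x₀‖ ^ 2 = ‖y - x₀‖ ^ 2 + 2 * ⟪y - x₀, v⟫ + ‖v‖ ^ 2 := by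
        rw [← norm_add_sq_real]; congr 2; abel
      have a4 : ‖y - v - x₀‖ ^ 2 = ‖y - x₀‖ ^ 2 - 2 * ⟪y - x₀, v⟫ + ‖v‖ ^ 2 := by
        rw [← norm_sub_sq_real]; congr 2; abel
      have a5 : ‖v‖ = h := by rw [hv, norm_smul_single hh]
      have a6 : ⟪n, v⟫ = h * n k := by
        rw [hv, real_inner_smul_right, EuclideanSpace.inner_single_right]; simp
      rw [a1, a2, a3, a4, a5, a6]; ring
    have hsum : ∑ k : Fin d, n k ^ 2 = 1 := by
      have := EuclideanSpace.norm_sq_eq n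
      rw [hn] at this
      simpa using this.symm
    rw [Finset.sum_congr rfl fun k _ => hpt k _ rfl, ← Finset.mul_sum, Finset.sum_sub_distrib,
      ← Finset.mul_sum, hsum]
    simp only [Finset.sum_const, Finset.card_univ, Fintype.card_fin, nsmul_eq_mul]
    have : 0 < C * h ^ 2 := by positivity
    nlinarith

lemma ConvexOn.closure_of_continuousOn {E : Type*} [NormedAddCommGroup E] [NormedSpace ℝ E]
    {s : Set E} {f : E → ℝ} (hf : ConvexOn ℝ s f) (hc : ContinuousOn f (closure s)) :
    ConvexOn ℝ (closure s) f := by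
  refine ⟨hf.1.closure, fun x hx y hy a b ha hb hab => ?_⟩
  obtain ⟨xn, hxn, hxl⟩ := mem_closure_iff_seq_limit.mp hx
  obtain ⟨yn, hyn, hyl⟩ := mem_closure_iff_seq_limit.mp hy
  have key : ∀ (z : E) (zn : ℕ → E), z ∈ closure s → (∀ n, zn n ∈ s) → Tendsto zn atTop (𝓝 z) →
      Tendsto (fun n => f (zn n)) atTop (𝓝 (f z)) := fun z zn hz hzn hzl =>
    (hc z hz).tendsto.comp (tendsto_nhdsWithin_iff.mpr
      ⟨hzl, Eventually.of_forall fun n => subset_closure (hzn n)⟩)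
  have h1 := key _ (fun n => a • xn n + b • yn n) (hf.1.closure hx hy ha hb hab)
    (fun n => hf.1 (hxn n) (hyn n) ha hb hab) ((hxl.const_smul a).add (hyl.const_smul b))
  have h2 := ((key x xn hx hxn hxl).const_mul a).add ((key y yn hy hyn hyl).const_mul b)
  exact le_of_tendsto_of_tendsto' h1 h2 fun n => hf.2 (hxn n) (hyn n) ha hb hab

lemma exists_affine_minorant {d : ℕ} {Ω : Set (Ed d)} {g : Ed d → ℝ}
    (hg : ContinuousOn g (closure Ω)) (hgc : ConvexOn ℝ Ω g) {x₀ : Ed d} (hx₀ : x₀ ∈ closure Ω)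
    {a : ℝ} (ha : a < g x₀) :
    ∃ (q : Ed d) (c : ℝ), (∀ y ∈ closure Ω, ⟪q, y⟫ + c ≤ g y) ∧ ⟪q, x₀⟫ + c = a := by
  obtain ⟨l, c, h1, h2⟩ := ConvexOn.exists_affine_le_of_lt (𝕜 := ℝ) hx₀ ha isClosed_closure
    hg.lowerSemicontinuousOn (hgc.closure_of_continuousOn hg)
  refine ⟨(InnerProductSpace.toDual ℝ (Ed d)).symm l, c, fun y hy => ?_, ?_⟩
  · have := h1 ⟨y, hy⟩
    rw [InnerProductSpace.toDual_symm_apply]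
    simpa using this
  · rw [InnerProductSpace.toDual_symm_apply]
    simpa using h2

/-- If a discrete solution drops below an affine minorant of the boundary data, its normal image
contains many disjoint balls. -/
lemma MeshSol.card_mul_le {i d : ℕ} {Ω : Set (Ed d)} {g : Ed d → ℝ} {A h : ℝ}
    {f u : Ed d → ℝ} (hs : MeshSol i d Ω g A h f u) (hb : Bornology.IsBounded Ω)
    (hh : 0 < h) {q n x₀ : Ed d} {c : ℝ} (hq : ∀ y ∈ closure Ω, ⟪q, y⟫ + c ≤ g y) (hn : ‖n‖ = 1)
    (hnt : ∀ y ∈ closure Ω, 0 ≤ ⟪n, x₀ - y⟫) {D : ℝ} (hD : 0 < D)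
    (hdiam : ∀ y ∈ closure Ω, ∀ z ∈ closure Ω, ‖y - z‖ ≤ D) {m : ℝ} (hm : 0 < m)
    {x : Ed d} (hx : x ∈ closure Ω ∩ lat d h) (hux : u x ≤ ⟪q, x⟫ + c - m) {N : ℕ}
    (hN : N * ⟪n, x₀ - x⟫ ≤ D / 2) :
    (N : ℝ) * ((m / (2 * D)) ^ d * (volume (Metric.ball (0 : Ed d) 1)).toReal) ≤ max A 0 := by
  set r := m / (2 * D) with hr
  have hr0 : 0 < r := by positivity
  have hrD : 2 * (r * D) = m := by rw [hr]; field_simp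
  set U : Set (Ed d) := ⋃ y ∈ meshInt d Ω h, subdiffI i d Ω h u y with hU
  have hball : ∀ j ∈ Finset.range N, Metric.ball (q + (2 * r * (j : ℝ)) • n) r ⊆ U := by
    intro j hj p hp
    set p' := p - (q + (2 * r * (j : ℝ)) • n) with hp'
    have hp'r : ‖p'‖ < r := by rwa [mem_ball_iff_norm] at hp
    have hpe : p = q + p' + (2 * r * (j : ℝ)) • n := by rw [hp']; abel
    obtain ⟨y, hy, hmin⟩ := (lat_inter_finite hh hb.closure).toFinset.exists_min_image
      (fun y => u y - ⟪p, y⟫) ⟨x, by simpa using hx⟩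
    rw [Set.Finite.mem_toFinset] at hy
    have hmin' : ∀ z ∈ closure Ω ∩ lat d h, u y - ⟪p, y⟫ ≤ u z - ⟪p, z⟫ := fun z hz =>
      hmin z ((Set.Finite.mem_toFinset _).mpr hz)
    by_cases hyi : y ∈ meshInt d Ω h
    · refine Set.mem_biUnion hyi (mem_subdiffI_of_forall fun z hz => ?_)
      have := hmin' z hz
      rw [inner_sub_right]; linarith
    · exfalso
      have h1 := hs.bc y ⟨hy, hyi⟩
      have h2 := hq y hy.1
      have h3 := hmin' x hx
      have h4 : ⟪p, y⟫ - ⟪p, x⟫ = ⟪q, y⟫ - ⟪q, x⟫ + ⟪p', y - x⟫ +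
          2 * r * j * (⟪n, x₀ - x⟫ - ⟪n, x₀ - y⟫) := by
        rw [hpe]
        simp only [inner_add_left, inner_sub_right, real_inner_smul_left]
        ring
      have h5 : ⟪p', y - x⟫ ≤ ‖p'‖ * D :=
        (real_inner_le_norm _ _).trans (by gcongr; exact hdiam y hy.1 x hx.1)
      have h6 : ‖p'‖ * D < r * D := by gcongr
      have h7 := hnt y hy.1
      have h8 := hnt x hx.1
      have hjN : (j : ℝ) ≤ N := by exact_mod_cast (Finset.mem_range.mp hj).le
      have h9 : r * (j * ⟪n, x₀ - x⟫) ≤ r * (D / 2) := by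
        gcongr
        exact le_trans (by gcongr) hN
      have h10 : 0 ≤ r * (j * ⟪n, x₀ - y⟫) := by positivity
      nlinarith
  have hdisj : Set.PairwiseDisjoint (↑(Finset.range N))
      fun j : ℕ => Metric.ball (q + (2 * r * (j : ℝ)) • n) r := by
    intro j _ k _ hjk
    apply Metric.ball_disjoint_ball
    rw [dist_eq_norm, add_sub_add_left_eq_sub, ← sub_smul, norm_smul, hn, mul_one,
      ← mul_sub, Real.norm_eq_abs, abs_mul, abs_of_pos (by positivity : 0 < 2 * r)]
    have : (1 : ℝ) ≤ |(j : ℝ) - k| := by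
      have : (1 : ℤ) ≤ |(j : ℤ) - k| := Int.one_le_abs (by omega)
      exact_mod_cast this
    nlinarith
  have hvol : ∑ j ∈ Finset.range N, volume (Metric.ball (q + (2 * r * (j : ℝ)) • n) r) ≤
      ENNReal.ofReal A := by
    rw [← measure_biUnion_finset hdisj fun j _ => Metric.isOpen_ball.measurableSet]
    exact (measure_mono (Set.iUnion₂_subset hball)).trans (hs.volume_biUnion_le_mass hb hh)
  simp only [Measure.addHaar_ball_of_pos volume _ hr0, Finset.sum_const, Finset.card_range,
    nsmul_eq_mul, finrank_euclideanSpace_fin] at hvol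
  have h2 := ENNReal.toReal_mono ENNReal.ofReal_ne_top hvol
  rw [ENNReal.toReal_mul, ENNReal.toReal_mul, ENNReal.toReal_ofReal (by positivity),
    ENNReal.toReal_ofReal'] at h2
  simpa using h2

lemma volume_unitBall_toReal_pos (d : ℕ) :
    0 < (volume (Metric.ball (0 : Ed d) 1)).toReal :=
  ENNReal.toReal_pos (Metric.measure_ball_pos volume _ one_pos).ne' measure_ball_lt_top.ne

lemma exists_norm_sub_le_closure {d : ℕ} {Ω : Set (Ed d)} (hb : Bornology.IsBounded Ω) :
    ∃ D > 0, ∀ y ∈ closure Ω, ∀ z ∈ closure Ω, ‖y - z‖ ≤ D := by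
  refine ⟨Metric.diam (closure Ω) + 1, add_pos_of_nonneg_of_pos Metric.diam_nonneg one_pos,
    fun y hy z hz => ?_⟩
  rw [← dist_eq_norm]
  have := Metric.dist_le_diam_of_mem hb.closure hy hz
  linarith

/-- Discrete solutions do not drop below the boundary data near a boundary point. -/
lemma exists_lower_barrier {d : ℕ} {Ω : Set (Ed d)} (ho : IsOpen Ω)
    (hc : Convex ℝ Ω) (hb : Bornology.IsBounded Ω) {g : Ed d → ℝ}
    (hg : ContinuousOn g (closure Ω)) (hgc : ConvexOn ℝ Ω g) (A : ℝ)
    {x₀ : Ed d} (hx₀ : x₀ ∈ frontier Ω) {ε : ℝ} (hε : 0 < ε) :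
    ∃ δ > 0, ∀ (i : ℕ) (h : ℝ) (f u : Ed d → ℝ), 0 < h →
      MeshSol i d Ω g A h f u → ∀ x ∈ closure Ω ∩ lat d h, ‖x - x₀‖ < δ → g x₀ - ε ≤ u x := by
  obtain ⟨n, hn, hnt⟩ := exists_unit_outer_normal ho hc hx₀
  have hx₀c := frontier_subset_closure hx₀
  obtain ⟨q, c, hq, hq0⟩ := exists_affine_minorant hg hgc hx₀c (show g x₀ - ε / 3 < g x₀ by linarith)
  obtain ⟨D, hD, hdiam⟩ := exists_norm_sub_le_closure hb
  set w := (volume (Metric.ball (0 : Ed d) 1)).toReal with hw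
  have hwpos : 0 < w := volume_unitBall_toReal_pos d
  have hκ : 0 < (ε / 3 / (2 * D)) ^ d * w := by positivity
  obtain ⟨N, hN⟩ := exists_nat_gt (max A 0 / ((ε / 3 / (2 * D)) ^ d * w))
  rw [div_lt_iff₀ hκ] at hN
  refine ⟨min (D / 2 / (N + 1)) (ε / 3 / (‖q‖ + 1)), by positivity, ?_⟩
  intro i h f u hh hs x hx hxδ
  by_contra! hcon
  have h1 : ‖x - x₀‖ < D / 2 / (N + 1) := hxδ.trans_le (min_le_left _ _)
  have h2 : ‖x - x₀‖ < ε / 3 / (‖q‖ + 1) := hxδ.trans_le (min_le_right _ _)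
  rw [lt_div_iff₀ (by positivity)] at h1 h2
  have h3 : -(ε / 3) ≤ ⟪q, x - x₀⟫ := by
    have := abs_le.mp (abs_real_inner_le_norm q (x - x₀))
    have := norm_nonneg (x - x₀)
    nlinarith
  rw [inner_sub_right] at h3
  have h4 : ⟪n, x₀ - x⟫ ≤ ‖x - x₀‖ := by
    have := real_inner_le_norm n (x₀ - x)
    rwa [hn, one_mul, norm_sub_rev] at this
  have h5 : N * ⟪n, x₀ - x⟫ ≤ D / 2 := by
    have := norm_nonneg (x - x₀)
    have : (N : ℝ) * ⟪n, x₀ - x⟫ ≤ N * ‖x - x₀‖ := by gcongr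
    linarith
  have := hs.card_mul_le hb hh hq hn hnt hD hdiam (show 0 < ε / 3 by positivity) hx
    (by linarith) h5
  linarith

/-- Discrete solutions are bounded uniformly in the mesh size. -/
lemma exists_uniform_bound {d : ℕ} (hd : 0 < d) {Ω : Set (Ed d)} (ho : IsOpen Ω)
    (hc : Convex ℝ Ω) (hb : Bornology.IsBounded Ω) {g : Ed d → ℝ}
    (hg : ContinuousOn g (closure Ω)) (hgc : ConvexOn ℝ Ω g) (A : ℝ)
    {x₀ : Ed d} (hx₀ : x₀ ∈ frontier Ω) :
    ∃ C > 0, ∀ (i : ℕ) (h : ℝ) (f u : Ed d → ℝ), 0 < h →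
      MeshSol i d Ω g A h f u → ∀ x ∈ closure Ω ∩ lat d h, |u x| ≤ C := by
  obtain ⟨B, hBc, -, hB⟩ := exists_upper_barrier hd ho hc hb hg hx₀ one_pos
  obtain ⟨n, hn, hnt⟩ := exists_unit_outer_normal ho hc hx₀
  have hx₀c := frontier_subset_closure hx₀
  obtain ⟨q, c, hq, -⟩ := exists_affine_minorant hg hgc hx₀c (show g x₀ - 1 < g x₀ by linarith)
  obtain ⟨D', hD', hdiam'⟩ := exists_norm_sub_le_closure hb
  set D := 2 * D' with hDD
  have hD : 0 < D := by positivity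
  have hdiam : ∀ y ∈ closure Ω, ∀ z ∈ closure Ω, ‖y - z‖ ≤ D := fun y hy z hz => by
    have := hdiam' y hy z hz
    linarith
  set w := (volume (Metric.ball (0 : Ed d) 1)).toReal with hw
  have hwpos : 0 < w := volume_unitBall_toReal_pos d
  have hcomp : IsCompact (closure Ω) := hb.isCompact_closure
  obtain ⟨C₁, hC₁⟩ := hcomp.exists_bound_of_continuousOn hBc.continuousOn
  obtain ⟨C₂, hC₂⟩ := hcomp.exists_bound_of_continuousOn
    (show ContinuousOn (fun y : Ed d => ⟪q, y⟫ + c) (closure Ω) by fun_prop)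
  set s := max A 0 / w + 1 with hs
  have hs1 : 1 ≤ s := by
    have : 0 ≤ max A 0 / w := div_nonneg (le_max_right _ _) hwpos.le
    linarith
  set m := s * (2 * D) with hm
  have hm0 : 0 < m := by positivity
  refine ⟨max C₁ (C₂ + m) + 1, ?_, ?_⟩
  · have := le_max_right C₁ (C₂ + m)
    have := (norm_nonneg _).trans (hC₂ x₀ hx₀c)
    linarith
  intro i h f u hh hsol x hx
  rw [abs_le]
  constructor
  · by_contra! hcon
    have h1 := le_max_right C₁ (C₂ + m)
    have h2 := (abs_le.mp (hC₂ x hx.1)).1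
    have h4 : ⟪n, x₀ - x⟫ ≤ D' := by
      have := real_inner_le_norm n (x₀ - x)
      rw [hn, one_mul] at this
      exact this.trans (hdiam' _ hx₀c _ hx.1)
    have h3 := hsol.card_mul_le hb hh hq hn hnt hD hdiam hm0 hx (N := 1)
      (by linarith) (by simp; linarith)
    rw [hm, mul_div_cancel_right₀ _ (by positivity)] at h3
    have h5 : s ≤ s ^ d := le_self_pow₀ hs1 (by omega)
    have h6 : max A 0 < s * w := by
      rw [hs, add_mul, div_mul_cancel₀ _ hwpos.ne']; linarith
    have h7 : s * w ≤ s ^ d * w := by gcongr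
    simp only [Nat.cast_one, one_mul] at h3
    linarith
  · have h1 := hB i A h f u hh hsol x hx
    have h2 := (abs_le.mp (hC₁ x hx.1)).2
    have h3 := le_max_left C₁ (C₂ + m)
    linarith

/-- Discrete solutions attain their boundary values uniformly in the mesh size. -/
lemma exists_boundary_modulus {d : ℕ} (hd : 0 < d) {Ω : Set (Ed d)} (ho : IsOpen Ω)
    (hc : Convex ℝ Ω) (hb : Bornology.IsBounded Ω) {g : Ed d → ℝ}
    (hg : ContinuousOn g (closure Ω)) (hgc : ConvexOn ℝ Ω g) (A : ℝ)
    {x₀ : Ed d} (hx₀ : x₀ ∈ frontier Ω) {ε : ℝ} (hε : 0 < ε) :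
    ∃ δ > 0, ∀ (i : ℕ) (h : ℝ) (f u : Ed d → ℝ), 0 < h →
      MeshSol i d Ω g A h f u → ∀ x ∈ closure Ω ∩ lat d h, ‖x - x₀‖ < δ → |u x - g x₀| ≤ ε := by
  obtain ⟨δ, hδ, hlow⟩ := exists_lower_barrier ho hc hb hg hgc A hx₀ hε
  obtain ⟨B, hBc, hB0, hB⟩ := exists_upper_barrier hd ho hc hb hg hx₀ (half_pos hε)
  obtain ⟨δ', hδ', hBδ⟩ := Metric.continuousAt_iff.mp hBc.continuousAt (ε / 2) (half_pos hε)
  refine ⟨min δ δ', lt_min hδ hδ', fun i h f u hh hs x hx hxδ => abs_le.mpr ⟨?_, ?_⟩⟩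
  · have := hlow i h f u hh hs x hx (hxδ.trans_le (min_le_left _ _))
    linarith
  · have h1 := hB i A h f u hh hs x hx
    have h2 := hBδ (show dist x x₀ < δ' by
      rw [dist_eq_norm]; exact hxδ.trans_le (min_le_right _ _))
    rw [Real.dist_eq, hB0] at h2
    have := (abs_lt.mp h2).2
    linarith

lemma closedBall_subset_of_convex {d : ℕ} {Ω : Set (Ed d)} (hc : Convex ℝ Ω) {ρ : ℝ} {x y : Ed d}
    (hx : Metric.closedBall x ρ ⊆ Ω) (hy : Metric.closedBall y ρ ⊆ Ω) {t : ℝ} (ht0 : 0 ≤ t)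
    (ht1 : t ≤ 1) : Metric.closedBall (x + t • (y - x)) ρ ⊆ Ω := by
  intro z hz
  set v := z - (x + t • (y - x)) with hv
  have hvn : ‖v‖ ≤ ρ := by rwa [mem_closedBall_iff_norm] at hz
  have h1 : x + v ∈ Ω := hx (by rwa [mem_closedBall_iff_norm, add_sub_cancel_left])
  have h2 : y + v ∈ Ω := hy (by rwa [mem_closedBall_iff_norm, add_sub_cancel_left])
  have h3 := hc h1 h2 (sub_nonneg.mpr ht1) ht0 (by ring)
  have : z = (1 - t) • (x + v) + t • (y + v) := by
    have : z = x + t • (y - x) + v := by rw [hv]; abel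
    rw [this]; module
  rwa [this]

lemma closedBall_subset_of_norm_le {d : ℕ} {Ω : Set (Ed d)} {ρ σ : ℝ} {x z : Ed d}
    (hx : Metric.closedBall x σ ⊆ Ω) (hz : ‖z - x‖ + ρ ≤ σ) : Metric.closedBall z ρ ⊆ Ω :=
  (Metric.closedBall_subset_closedBall' (by rw [dist_eq_norm]; linarith)).trans hx

/-- Interior Lipschitz estimate for bounded discrete convex functions. -/
lemma DiscConvex.sub_le_mul_norm {d : ℕ} {Ω : Set (Ed d)} {h : ℝ} {u : Ed d → ℝ}
    (hu : DiscConvex d Ω h u) (hh : 0 < h) {C : ℝ} (hC : 0 < C)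
    (hbd : ∀ x ∈ closure Ω ∩ lat d h, |u x| ≤ C) {ρ : ℝ} (hρ : h ≤ ρ) {x y : Ed d}
    (hx : x ∈ lat d h) (hxb : Metric.closedBall x (2 * ρ) ⊆ Ω) (hy : y ∈ closure Ω ∩ lat d h) :
    u y - u x ≤ 4 * C / ρ * ‖y - x‖ := by
  have hρ0 : 0 < ρ := hh.trans_le hρ
  have hxΩ : x ∈ Ω := hxb (Metric.mem_closedBall_self (by linarith))
  have hx1 := abs_le.mp (hbd x ⟨subset_closure hxΩ, hx⟩)
  have hy1 := abs_le.mp (hbd y hy)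
  set e := y - x with he
  have hel : e ∈ lat d h := lat_sub hy.2 hx
  rcases eq_or_ne e 0 with he0 | he0
  · have : y = x := sub_eq_zero.mp he0
    rw [he0, this]; simp
  have hen : 0 < ‖e‖ := norm_pos_iff.mpr he0
  rcases lt_or_ge ρ ‖e‖ with hlt | hle
  · have : 4 * C / ρ * ρ ≤ 4 * C / ρ * ‖e‖ := by gcongr
    rw [div_mul_cancel₀ _ hρ0.ne'] at this
    linarith
  · set k := ⌊ρ / ‖e‖⌋₊ with hk
    have h1 : (1 : ℝ) ≤ ρ / ‖e‖ := by rwa [one_le_div hen]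
    have hk1 : 1 ≤ k := Nat.le_floor (by simpa using h1)
    have hk2 : (k : ℝ) * ‖e‖ ≤ ρ := by
      rw [← le_div_iff₀ hen]; exact Nat.floor_le (by positivity)
    have hk3 : ρ / ‖e‖ < 2 * k := by
      have := Nat.lt_floor_add_one (ρ / ‖e‖)
      have : (1 : ℝ) ≤ k := by exact_mod_cast hk1
      rw [← hk] at *
      linarith
    have hb : ∀ j : ℕ, j ≤ k → Metric.closedBall (x + (j : ℝ) • e) ρ ⊆ Ω := fun j hj => by
      refine closedBall_subset_of_norm_le hxb ?_
      rw [add_sub_cancel_left, norm_smul, Real.norm_natCast]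
      have : (j : ℝ) * ‖e‖ ≤ k * ‖e‖ := by gcongr
      linarith
    have hmem : ∀ j : ℕ, j ≤ k → x + (j : ℝ) • e ∈ meshInt d Ω h := fun j hj =>
      mem_meshInt_of_closedBall hh hρ (lat_add hx (lat_nsmul hel j)) (hb j hj)
    have hend := (meshInt_subset (hmem k le_rfl))
    have h2 := hu.le_of_chain ⟨subset_closure hxΩ, hx⟩ hel (k := k) (fun j _ hj => hmem j hj.le)
      hend.1
    have h3 := abs_le.mp (hbd _ hend)
    have hxe : x + e = y := by rw [he]; abel
    rw [hxe] at h2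
    have hk0 : (0 : ℝ) < k := by exact_mod_cast hk1
    have h4 : k * (u y - u x) ≤ 2 * C := by linarith
    have h5 : 2 * C ≤ k * (4 * C / ρ * ‖e‖) := by
      rw [div_lt_iff₀ hen] at hk3
      have : k * (4 * C / ρ * ‖e‖) = 2 * C * (2 * k * ‖e‖ / ρ) := by field_simp; ring
      rw [this]
      have : 1 ≤ 2 * k * ‖e‖ / ρ := by rw [one_le_div hρ0]; exact hk3.le
      nlinarith
    exact le_of_mul_le_mul_left (h4.trans h5) hk0

lemma admB_standard {d : ℕ} {Ω : Set (Ed d)} {h ρ : ℝ} (hh : 0 < h) (hρ : h ≤ ρ)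
    {x : Ed d} (hx : x ∈ lat d h) (hb : Metric.closedBall x ρ ⊆ Ω) :
    admB d Ω h x fun k => h • EuclideanSpace.single k (1 : ℝ) := by
  have hm := mem_meshInt_of_closedBall hh hρ hx hb
  refine ⟨fun k => lat_single h k, fun k h0 => ?_, fun j k hjk => ?_, fun k => (hm.2 k).1,
    fun k => (hm.2 k).2⟩
  · have := norm_smul_single hh k
    have h0' : h • EuclideanSpace.single k (1 : ℝ) = 0 := h0
    rw [h0', norm_zero] at this
    exact hh.ne this
  · rw [real_inner_smul_left, real_inner_smul_right, EuclideanSpace.inner_single_left]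
    simp [hjk]

lemma norm_le_of_mem_subdiff1 {d : ℕ} {Ω : Set (Ed d)} {h : ℝ} {u : Ed d → ℝ}
    (hu : DiscConvex d Ω h u) (hh : 0 < h) {C : ℝ} (hC : 0 < C)
    (hbd : ∀ x ∈ closure Ω ∩ lat d h, |u x| ≤ C) {ρ : ℝ} (hρ : h ≤ ρ) {x p : Ed d}
    (hx : x ∈ lat d h) (hxb : Metric.closedBall x (2 * ρ) ⊆ Ω) (hp : p ∈ subdiff1 d Ω h u x) :
    ‖p‖ ≤ d * (4 * C / ρ) := by
  have hρ0 : 0 < ρ := hh.trans_le hρ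
  have hadm := admB_standard hh (by linarith : h ≤ 2 * ρ) hx hxb
  refine norm_le_card_mul fun k => ?_
  obtain ⟨h1, h2⟩ := hp _ hadm k
  have h3 := hu.sub_le_mul_norm hh hC hbd hρ hx hxb (hadm.2.2.2.1 k)
  have h4 := hu.sub_le_mul_norm hh hC hbd hρ hx hxb (hadm.2.2.2.2 k)
  rw [add_sub_cancel_left, norm_smul_single hh] at h3
  rw [sub_sub_cancel_left, norm_neg, norm_smul_single hh] at h4
  have h5 : ⟪p, h • EuclideanSpace.single k (1 : ℝ)⟫ = h * p k := by
    rw [real_inner_smul_right, EuclideanSpace.inner_single_right]; simp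
  rw [h5] at h1 h2
  rw [abs_le]
  constructor
  · have : h * -(4 * C / ρ) ≤ h * p k := by linarith
    exact le_of_mul_le_mul_left this hh
  · have : h * p k ≤ h * (4 * C / ρ) := by linarith
    exact le_of_mul_le_mul_left this hh

/-- Elements of the first discrete normal mapping are approximate subgradients, and exact ones at
distances of order `√h`. -/
lemma exists_approx_subgradient {d : ℕ} {Ω : Set (Ed d)} (hc : Convex ℝ Ω)
    (hb : Bornology.IsBounded Ω) {C ρ : ℝ} (hC : 0 < C) (hρ : 0 < ρ) :
    ∃ K ≥ 0, ∀ M > 0, ∃ h₀ > 0, ∀ (h : ℝ) (u : Ed d → ℝ), 0 < h → h < h₀ → DiscConvex d Ω h u →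
      (∀ x ∈ closure Ω ∩ lat d h, |u x| ≤ C) → ∀ x ∈ lat d h, ∀ y ∈ lat d h,
      Metric.closedBall x (2 * ρ) ⊆ Ω → Metric.closedBall y (2 * ρ) ⊆ Ω →
      ∀ p ∈ subdiff1 d Ω h u x,
      (‖y - x‖ ≤ M * √h → u x + ⟪p, y - x⟫ ≤ u y) ∧
      u x + ⟪p, y - x⟫ - K * ‖y - x‖ * √h / M ≤ u y := by
  obtain ⟨D, hD, hdiam⟩ := exists_norm_sub_le_closure hb
  set L := 4 * C / ρ with hL
  have hL0 : 0 < L := by positivity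
  refine ⟨3 * d * ((d + 1) * L), by positivity, fun M hM => ?_⟩
  obtain ⟨h₁, hh₁, hadm⟩ := exists_admB_of_short (d := d) M ρ hM hρ
  set s₀ := min (M / (2 * (d + 1))) (ρ * M / (3 * D * (d + 1))) with hs₀
  have hs₀pos : 0 < s₀ := by positivity
  refine ⟨min (min h₁ ρ) (s₀ ^ 2), by positivity, ?_⟩
  intro h u hh hh0 hu hbd x hx y hy hxb hyb p hp
  have hhh₁ : h < h₁ := hh0.trans_le ((min_le_left _ _).trans (min_le_left _ _))
  have hhρ : h ≤ ρ := (hh0.trans_le ((min_le_left _ _).trans (min_le_right _ _))).le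
  have hss : √h < s₀ := by
    rw [Real.sqrt_lt' hs₀pos]; exact hh0.trans_le (min_le_right _ _)
  have hs1 : √h < M / (2 * (d + 1)) := hss.trans_le (min_le_left _ _)
  have hs2 : √h < ρ * M / (3 * D * (d + 1)) := hss.trans_le (min_le_right _ _)
  have hs0 : 0 < √h := Real.sqrt_pos.mpr hh
  have hsq : √h * √h = h := Real.mul_self_sqrt hh.le
  rw [lt_div_iff₀ (by positivity)] at hs1 hs2
  have hxρ : Metric.closedBall x ρ ⊆ Ω :=
    (Metric.closedBall_subset_closedBall (by linarith)).trans hxb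
  have exact_of : ∀ e ∈ lat d h, ‖e‖ ≤ M * √h → ⟪p, e⟫ ≤ u (x + e) - u x := by
    intro e he hen
    rcases eq_or_ne e 0 with rfl | he0
    · simp
    obtain ⟨b, hb, k, rfl⟩ := hadm h hh hhh₁ Ω x hx hxρ e he he0 hen
    exact (hp b hb k).2
  have hxy : x + (y - x) = y := by abel
  have hshort : ‖y - x‖ ≤ M * √h → u x + ⟪p, y - x⟫ ≤ u y := by
    intro hle
    have := exact_of (y - x) (lat_sub hy hx) hle
    rw [hxy] at this
    linarith
  refine ⟨hshort, ?_⟩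
  rcases le_or_gt ‖y - x‖ (M * √h) with hle | hgt
  · have h1 := hshort hle
    have h2 : 0 ≤ 3 * d * ((d + 1) * L) * ‖y - x‖ * √h / M := by positivity
    linarith
  set N := ‖y - x‖ with hN
  set r := M * √h with hr
  have hr0 : 0 < r := by positivity
  have hN0 : 0 < N := hr0.trans hgt
  have hyΩ : y ∈ closure Ω := subset_closure (hyb (Metric.mem_closedBall_self (by linarith)))
  have hxΩ : x ∈ closure Ω := subset_closure (hxb (Metric.mem_closedBall_self (by linarith)))
  have hND : N ≤ D := hdiam y hyΩ x hxΩ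
  set k := ⌈2 * N / r⌉₊ with hk
  have hk1 : 2 * N / r ≤ k := Nat.le_ceil _
  have hk2 : (k : ℝ) < 2 * N / r + 1 := Nat.ceil_lt_add_one (by positivity)
  have hk0 : (0 : ℝ) < k := lt_of_lt_of_le (by positivity) hk1
  have hk3 : (k : ℝ) * r ≤ 3 * N := by
    have := mul_lt_mul_of_pos_right hk2 hr0
    rw [add_mul, div_mul_cancel₀ _ hr0.ne'] at this
    linarith
  rw [div_le_iff₀ hr0] at hk1
  obtain ⟨q, hq, hqn⟩ := exists_lat_near hh ((k : ℝ)⁻¹ • (y - x))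
  have hqr : ‖q‖ ≤ r := by
    have h1 : ‖(k : ℝ)⁻¹ • (y - x)‖ ≤ r / 2 := by
      rw [norm_smul, norm_inv, Real.norm_natCast, ← hN, inv_mul_le_iff₀ hk0]
      linarith
    have h2 : d * h ≤ r / 2 := by
      rw [← hsq, hr]
      nlinarith
    have h3 := norm_le_norm_add_norm_sub ((k : ℝ)⁻¹ • (y - x)) q
    rw [norm_sub_rev] at h3
    linarith
  have herr : k * (d * h) ≤ 3 * d * N * √h / M := by
    rw [le_div_iff₀ hM]
    calc k * (d * h) * M = k * (d * (√h * √h)) * M := by rw [hsq]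
      _ = d * √h * (k * r) := by rw [hr]; ring
      _ ≤ d * √h * (3 * N) := by gcongr
      _ = _ := by ring
  have herrρ : k * (d * h) ≤ ρ := by
    refine herr.trans ?_
    rw [div_le_iff₀ hM]
    have : 3 * d * N * √h ≤ 3 * (d + 1) * D * √h := by gcongr; linarith
    linarith
  have hbj : ∀ j : ℕ, j ≤ k → Metric.closedBall (x + (j : ℝ) • q) ρ ⊆ Ω := by
    intro j hj
    have hjk : (j : ℝ) ≤ k := by exact_mod_cast hj
    have h1 := closedBall_subset_of_convex hc hxb hyb (t := j / k) (by positivity)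
      (by rw [div_le_one hk0]; exact hjk)
    refine closedBall_subset_of_norm_le h1 ?_
    have h2 : x + (j : ℝ) • q - (x + ((j : ℝ) / k) • (y - x)) =
        (j : ℝ) • (q - (k : ℝ)⁻¹ • (y - x)) := by
      module
    rw [h2, norm_smul, Real.norm_natCast]
    have : (j : ℝ) * ‖q - (k : ℝ)⁻¹ • (y - x)‖ ≤ k * (d * h) := by gcongr
    linarith
  have hmem : ∀ j : ℕ, j ≤ k → x + (j : ℝ) • q ∈ meshInt d Ω h := fun j hj =>
    mem_meshInt_of_closedBall hh hhρ (lat_add hx (lat_nsmul hq j)) (hbj j hj)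
  set z := x + (k : ℝ) • q with hz
  have hzm := meshInt_subset (hmem k le_rfl)
  have hchain := hu.le_of_chain ⟨hxΩ, hx⟩ hq (k := k) (fun j _ hj => hmem j hj.le) hzm.1
  have hpq := exact_of q hq hqr
  have hzy : ‖z - y‖ ≤ k * (d * h) := by
    have : z - y = (k : ℝ) • (q - (k : ℝ)⁻¹ • (y - x)) := by
      rw [smul_sub, smul_smul, mul_inv_cancel₀ hk0.ne', one_smul, hz]; abel
    rw [this, norm_smul, Real.norm_natCast]
    gcongr
  have hlip := hu.sub_le_mul_norm hh hC hbd hhρ hy hyb hzm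
  have hpn := norm_le_of_mem_subdiff1 hu hh hC hbd hhρ hx hxb hp
  have hpz : ⟪p, y - x⟫ ≤ k * ⟪p, q⟫ + d * L * (k * (d * h)) := by
    have h1 : y - x = (k : ℝ) • q + (y - z) := by rw [hz]; abel
    rw [h1, inner_add_right, real_inner_smul_right]
    have h2 : ⟪p, y - z⟫ ≤ ‖p‖ * ‖y - z‖ := real_inner_le_norm _ _
    rw [norm_sub_rev y z] at h2
    have h3 : ‖p‖ * ‖z - y‖ ≤ d * L * (k * (d * h)) := by gcongr
    linarith
  have h1 : k * ⟪p, q⟫ ≤ k * (u (x + q) - u x) := by gcongr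
  have h2 : L * ‖z - y‖ ≤ L * (k * (d * h)) := by gcongr
  have h3 : (d + 1) * L * (k * (d * h)) ≤ (d + 1) * L * (3 * d * N * √h / M) := by gcongr
  have h4 : (d + 1) * L * (3 * d * N * √h / M) = 3 * d * ((d + 1) * L) * N * √h / M := by ring
  linarith

/-- The discrete normal images, sheared by a multiple of the identity, are disjoint in the
interior. -/
lemma exists_sheared_disjoint {d : ℕ} {Ω : Set (Ed d)} (hc : Convex ℝ Ω)
    (hb : Bornology.IsBounded Ω) {C ρ lam : ℝ} (hC : 0 < C) (hρ : 0 < ρ) (hl : 0 < lam) :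
    ∃ h₀ > 0, ∀ (h : ℝ) (u : Ed d → ℝ), 0 < h → h < h₀ → DiscConvex d Ω h u →
      (∀ x ∈ closure Ω ∩ lat d h, |u x| ≤ C) → ∀ x ∈ lat d h, ∀ y ∈ lat d h,
      Metric.closedBall x (2 * ρ) ⊆ Ω → Metric.closedBall y (2 * ρ) ⊆ Ω → x ≠ y →
      ∀ p ∈ subdiff1 d Ω h u x, ∀ q ∈ subdiff1 d Ω h u y, p + lam • x ≠ q + lam • y := by
  obtain ⟨K, hK, H⟩ := exists_approx_subgradient hc hb hC hρ
  set M := 2 * K / lam + 1 with hM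
  have hM1 : 1 ≤ M := by
    have : 0 ≤ 2 * K / lam := by positivity
    linarith
  have hM0 : 0 < M := by linarith
  obtain ⟨h₀, hh₀, H⟩ := H M hM0
  refine ⟨h₀, hh₀, fun h u hh hhh hu hbd x hx y hy hxb hyb hxy p hp q hq heq => ?_⟩
  obtain ⟨a1, a2⟩ := H h u hh hhh hu hbd x hx y hy hxb hyb p hp
  obtain ⟨b1, b2⟩ := H h u hh hhh hu hbd y hy x hx hyb hxb q hq
  rw [norm_sub_rev] at b1 b2
  set N := ‖y - x‖ with hN
  have hN0 : 0 < N := norm_pos_iff.mpr (sub_ne_zero.mpr hxy.symm)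
  have hpq : ⟪p, y - x⟫ + ⟪q, x - y⟫ = lam * N ^ 2 := by
    have h1 : p = q + lam • (y - x) := by
      have : p = q + lam • y - lam • x := by rw [← heq]; abel
      rw [this, smul_sub]; abel
    rw [h1, inner_add_left, real_inner_smul_left, real_inner_self_eq_norm_sq, ← hN,
      inner_sub_right q y x, inner_sub_right q x y]
    ring
  have hshort : N ≤ M * √h := by
    have h1 : lam * N ^ 2 ≤ 2 * (K * N * √h / M) := by linarith
    have h2 : N * (lam * N) ≤ N * (2 * K * √h / M) := by
      calc N * (lam * N) = lam * N ^ 2 := by ring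
        _ ≤ 2 * (K * N * √h / M) := h1
        _ = _ := by ring
    have h3 := le_of_mul_le_mul_left h2 hN0
    rw [le_div_iff₀ hM0] at h3
    have h4 : 2 * K ≤ lam * M ^ 2 := by
      have h5 : lam * M = 2 * K + lam := by rw [hM]; field_simp
      nlinarith
    have h5 : lam * M * N ≤ lam * M * (M * √h) := by
      have : 2 * K * √h ≤ lam * M ^ 2 * √h := by gcongr
      linarith
    exact le_of_mul_le_mul_left h5 (by positivity)
  have c1 := a1 hshort
  have c2 := b1 hshort
  have : 0 < lam * N ^ 2 := by positivity
  linarith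

/-- The mesh functions `U n` on `ℤ^d_{h n}` converge to `u` locally uniformly on `closure Ω`. -/
def MeshLim (d : ℕ) (Ω : Set (Ed d)) (h : ℕ → ℝ) (U : ℕ → Ed d → ℝ) (u : Ed d → ℝ) : Prop :=
  ∀ x ∈ closure Ω, ∀ ε > 0, ∃ δ > 0, ∀ᶠ n in atTop, ∀ y ∈ closure Ω ∩ lat d (h n),
    ‖y - x‖ < δ → |U n y - u x| ≤ ε

lemma eventually_exists_lat_near {d : ℕ} {Ω : Set (Ed d)} (ho : IsOpen Ω) {h : ℕ → ℝ}
    (hh : ∀ n, 0 < h n) (hl : Tendsto h atTop (𝓝 0)) {x : Ed d} (hx : x ∈ closure Ω) {δ : ℝ}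
    (hδ : 0 < δ) : ∀ᶠ n in atTop, ∃ y ∈ closure Ω ∩ lat d (h n), ‖y - x‖ < δ := by
  obtain ⟨z, hz, hzx⟩ := Metric.mem_closure_iff.mp hx (δ / 2) (half_pos hδ)
  obtain ⟨r, hr, hrΩ⟩ := Metric.isOpen_iff.mp ho z hz
  have h1 : Tendsto (fun n => d * h n) atTop (𝓝 0) := by simpa using hl.const_mul (d : ℝ)
  filter_upwards [h1.eventually_lt_const (lt_min hr (half_pos hδ))] with n hn
  obtain ⟨y, hy, hyz⟩ := exists_lat_near (hh n) z
  have h2 : ‖y - z‖ < min r (δ / 2) := hyz.trans_lt hn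
  refine ⟨y, ⟨subset_closure (hrΩ (mem_ball_iff_norm.mpr (h2.trans_le (min_le_left _ _)))), hy⟩, ?_⟩
  have h3 := norm_add_le (y - z) (z - x)
  rw [sub_add_sub_cancel] at h3
  rw [dist_comm, dist_eq_norm] at hzx
  have := h2.trans_le (min_le_right _ _)
  linarith

lemma exists_closedBall_two_mul_subset {d : ℕ} {Ω : Set (Ed d)} (ho : IsOpen Ω) {x : Ed d}
    (hx : x ∈ Ω) : ∃ ρ > 0, ∀ y, ‖y - x‖ ≤ ρ → Metric.closedBall y (2 * ρ) ⊆ Ω := by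
  obtain ⟨r, hr, hrΩ⟩ := Metric.nhds_basis_closedBall.mem_iff.mp (ho.mem_nhds hx)
  exact ⟨r / 3, by positivity, fun y hy => closedBall_subset_of_norm_le hrΩ (by linarith)⟩

lemma frontier_nonempty_of_isBounded {d : ℕ} (hd : 0 < d) {Ω : Set (Ed d)}
    (hb : Bornology.IsBounded Ω) (hne : Ω.Nonempty) : (frontier Ω).Nonempty := by
  rw [nonempty_frontier_iff]
  refine ⟨hne, fun hu => ?_⟩
  have : NeZero d := ⟨hd.ne'⟩
  exact NormedSpace.unbounded_univ ℝ (Ed d) (hu ▸ hb)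

/-- Discrete solutions are equicontinuous up to the boundary. -/
lemma exists_equicontinuity_modulus {d : ℕ} (hd : 0 < d) {Ω : Set (Ed d)} (ho : IsOpen Ω)
    (hc : Convex ℝ Ω) (hb : Bornology.IsBounded Ω) {g : Ed d → ℝ}
    (hg : ContinuousOn g (closure Ω)) (hgc : ConvexOn ℝ Ω g) (A : ℝ)
    {x : Ed d} (hx : x ∈ closure Ω) {ε : ℝ} (hε : 0 < ε) :
    ∃ δ > 0, ∃ h₀ > 0, ∀ (i : ℕ) (h : ℝ) (f u : Ed d → ℝ), 0 < h → h < h₀ →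
      MeshSol i d Ω g A h f u → ∀ y ∈ closure Ω ∩ lat d h, ∀ z ∈ closure Ω ∩ lat d h,
      ‖y - x‖ < δ → ‖z - x‖ < δ → u y - u z ≤ ε := by
  by_cases hxΩ : x ∈ Ω
  · obtain ⟨x₀, hx₀⟩ := frontier_nonempty_of_isBounded hd hb ⟨x, hxΩ⟩
    obtain ⟨C, hC, hbd⟩ := exists_uniform_bound hd ho hc hb hg hgc A hx₀
    obtain ⟨ρ, hρ, hball⟩ := exists_closedBall_two_mul_subset ho hxΩ
    refine ⟨min ρ (ε * ρ / (8 * C)), by positivity, ρ, hρ, ?_⟩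
    intro i h f u hh hhρ hs y hy z hz hyx hzx
    have h1 := hs.conv.sub_le_mul_norm hh hC (hbd i h f u hh hs) hhρ.le hz.2
      (hball z (hzx.le.trans (min_le_left _ _))) hy
    have h2 : ‖y - z‖ ≤ 2 * (ε * ρ / (8 * C)) := by
      have h3 := norm_sub_le (y - x) (z - x)
      rw [sub_sub_sub_cancel_right] at h3
      have h4 := hyx.trans_le (min_le_right _ _)
      have h5 := hzx.trans_le (min_le_right _ _)
      linarith
    have h3 : 4 * C / ρ * ‖y - z‖ ≤ 4 * C / ρ * (2 * (ε * ρ / (8 * C))) := by gcongr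
    have h4 : 4 * C / ρ * (2 * (ε * ρ / (8 * C))) = ε := by field_simp; norm_num
    linarith
  · have hxf : x ∈ frontier Ω := by rw [ho.frontier_eq]; exact ⟨hx, hxΩ⟩
    obtain ⟨δ, hδ, H⟩ := exists_boundary_modulus hd ho hc hb hg hgc A hxf (half_pos hε)
    refine ⟨δ, hδ, 1, one_pos, ?_⟩
    intro i h f u hh _ hs y hy z hz hyx hzx
    have h1 := abs_le.mp (H i h f u hh hs y hy hyx)
    have h2 := abs_le.mp (H i h f u hh hs z hz hzx)
    linarith

/-- Sequences of discrete solutions are precompact for locally uniform convergence. -/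
lemma exists_subseq_meshLim {d : ℕ} (hd : 0 < d) {Ω : Set (Ed d)} (ho : IsOpen Ω)
    (hc : Convex ℝ Ω) (hb : Bornology.IsBounded Ω) (hne : Ω.Nonempty) {g : Ed d → ℝ}
    (hg : ContinuousOn g (closure Ω)) (hgc : ConvexOn ℝ Ω g) {A : ℝ} {i : ℕ} {h : ℕ → ℝ}
    (hh : ∀ n, 0 < h n) (hl : Tendsto h atTop (𝓝 0)) {F U : ℕ → Ed d → ℝ}
    (hs : ∀ n, MeshSol i d Ω g A (h n) (F n) (U n)) :
    ∃ φ : ℕ → ℕ, StrictMono φ ∧ ∃ u, MeshLim d Ω (h ∘ φ) (U ∘ φ) u := by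
  obtain ⟨x₀, hx₀⟩ := frontier_nonempty_of_isBounded hd hb hne
  obtain ⟨C, hC, hbd⟩ := exists_uniform_bound hd ho hc hb hg hgc A hx₀
  have hne' : Nonempty Ω := ⟨⟨_, hne.some_mem⟩⟩
  choose r hr using fun n (x : Ed d) => exists_lat_near (hh n) x
  set q := TopologicalSpace.denseSeq Ω with hq
  classical
  set v : ℕ → ℕ → ℝ := fun n j => if r n (q j) ∈ closure Ω then U n (r n (q j)) else 0 with hv
  have hvK : ∀ n, v n ∈ Set.pi Set.univ fun _ : ℕ => Set.Icc (-C) C := fun n j _ => by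
    refine abs_le.mp ?_
    rw [hv]
    dsimp only
    split_ifs with hm
    · exact hbd i _ _ _ (hh n) (hs n) _ ⟨hm, (hr n _).1⟩
    · rw [abs_zero]; exact hC.le
  obtain ⟨V, -, φ, hφ, hV⟩ := (isCompact_univ_pi fun _ : ℕ => isCompact_Icc).tendsto_subseq hvK
  have hVj : ∀ j, Tendsto (fun n => v (φ n) j) atTop (𝓝 (V j)) := tendsto_pi_nhds.mp hV
  have hlφ : Tendsto (h ∘ φ) atTop (𝓝 0) := hl.comp hφ.tendsto_atTop
  have hnear : ∀ x ∈ Ω, ∀ δ > 0, ∀ᶠ n in atTop, r (φ n) x ∈ closure Ω ∩ lat d (h (φ n)) ∧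
      ‖r (φ n) x - x‖ < δ := by
    intro x hx δ hδ
    obtain ⟨ρ, hρ, hρΩ⟩ := Metric.isOpen_iff.mp ho x hx
    have h1 : Tendsto (fun n => d * h (φ n)) atTop (𝓝 0) := by simpa using hlφ.const_mul (d : ℝ)
    filter_upwards [h1.eventually_lt_const (lt_min hρ hδ)] with n hn
    have h2 := (hr (φ n) x).2.trans_lt hn
    exact ⟨⟨subset_closure (hρΩ (mem_ball_iff_norm.mpr (h2.trans_le (min_le_left _ _)))),
      (hr (φ n) x).1⟩, h2.trans_le (min_le_right _ _)⟩
  have key : ∀ x ∈ closure Ω, ∀ ε > 0, ∃ c, ∃ δ > 0, ∀ᶠ n in atTop,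
      ∀ y ∈ closure Ω ∩ lat d (h (φ n)), ‖y - x‖ < δ → |U (φ n) y - c| ≤ ε := by
    intro x hx ε hε
    obtain ⟨δ, hδ, h₀, hh₀, H⟩ := exists_equicontinuity_modulus hd ho hc hb hg hgc A hx
      (half_pos hε)
    obtain ⟨z, hz, hzx⟩ := Metric.mem_closure_iff.mp hx (δ / 2) (half_pos hδ)
    obtain ⟨j, hj⟩ := (TopologicalSpace.denseRange_denseSeq Ω).exists_dist_lt ⟨z, hz⟩ (half_pos hδ)
    have hqx : ‖(q j : Ed d) - x‖ < δ := by
      have h1 : dist z (q j : Ed d) < δ / 2 := hj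
      have h2 := dist_triangle x z (q j : Ed d)
      rw [dist_comm, dist_eq_norm] at h2
      linarith
    refine ⟨V j, δ, hδ, ?_⟩
    filter_upwards [hnear (q j) (q j).2 (δ - ‖(q j : Ed d) - x‖) (by linarith),
      hlφ.eventually_lt_const hh₀, (Metric.tendsto_nhds.mp (hVj j)) (ε / 2) (half_pos hε)]
      with n hn hn0 hnV y hy hyx
    have h3 : ‖r (φ n) (q j) - x‖ < δ := by
      have := norm_add_le (r (φ n) (q j) - q j) ((q j : Ed d) - x)
      rw [sub_add_sub_cancel] at this
      linarith [hn.2]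
    have h1 := H i _ _ _ (hh (φ n)) hn0 (hs (φ n)) y hy _ hn.1 hyx h3
    have h2 := H i _ _ _ (hh (φ n)) hn0 (hs (φ n)) _ hn.1 y hy h3 hyx
    have h4 : v (φ n) j = U (φ n) (r (φ n) (q j)) := if_pos hn.1.1
    rw [h4, Real.dist_eq] at hnV
    have h5 := abs_lt.mp hnV
    rw [abs_le]
    constructor <;> linarith
  have key2 : ∀ x ∈ closure Ω, ∃ L, ∀ ε > 0, ∃ δ > 0, ∀ᶠ n in atTop,
      ∀ y ∈ closure Ω ∩ lat d (h (φ n)), ‖y - x‖ < δ → |U (φ n) y - L| ≤ ε := by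
    intro x hx
    by_cases hxΩ : x ∈ Ω
    · have hcau : CauchySeq fun n => U (φ n) (r (φ n) x) := by
        rw [Metric.cauchySeq_iff]
        intro ε hε
        obtain ⟨c, δ, hδ, H⟩ := key x hx (ε / 3) (by positivity)
        obtain ⟨N, hN⟩ := eventually_atTop.mp (H.and (hnear x hxΩ δ hδ))
        refine ⟨N, fun m hm n hn => ?_⟩
        have h1 := abs_le.mp ((hN m hm).1 _ (hN m hm).2.1 (hN m hm).2.2)
        have h2 := abs_le.mp ((hN n hn).1 _ (hN n hn).2.1 (hN n hn).2.2)
        rw [Real.dist_eq, abs_lt]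
        constructor <;> linarith
      obtain ⟨L, hL⟩ := cauchySeq_tendsto_of_complete hcau
      refine ⟨L, fun ε hε => ?_⟩
      obtain ⟨c, δ, hδ, H⟩ := key x hx (ε / 3) (by positivity)
      refine ⟨δ, hδ, ?_⟩
      filter_upwards [H, hnear x hxΩ δ hδ, (Metric.tendsto_nhds.mp hL) (ε / 3) (by positivity)]
        with n hn hnr hnL y hy hyx
      have h1 := abs_le.mp (hn y hy hyx)
      have h2 := abs_le.mp (hn _ hnr.1 hnr.2)
      rw [Real.dist_eq] at hnL
      have h3 := abs_lt.mp hnL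
      rw [abs_le]
      constructor <;> linarith
    · have hxf : x ∈ frontier Ω := by rw [ho.frontier_eq]; exact ⟨hx, hxΩ⟩
      refine ⟨g x, fun ε hε => ?_⟩
      obtain ⟨δ, hδ, H⟩ := exists_boundary_modulus hd ho hc hb hg hgc A hxf hε
      exact ⟨δ, hδ, Eventually.of_forall fun n y hy hyx => H i _ _ _ (hh _) (hs _) y hy hyx⟩
  choose! u hu using key2
  exact ⟨φ, hφ, u, hu⟩

lemma MeshLim.comp_strictMono {d : ℕ} {Ω : Set (Ed d)} {h : ℕ → ℝ} {U : ℕ → Ed d → ℝ}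
    {u : Ed d → ℝ} (hu : MeshLim d Ω h U u) {φ : ℕ → ℕ} (hφ : StrictMono φ) :
    MeshLim d Ω (h ∘ φ) (U ∘ φ) u := fun x hx ε hε => by
  obtain ⟨δ, hδ, H⟩ := hu x hx ε hε
  exact ⟨δ, hδ, hφ.tendsto_atTop.eventually H⟩

lemma MeshLim.continuousOn {d : ℕ} {Ω : Set (Ed d)} (ho : IsOpen Ω) {h : ℕ → ℝ}
    (hh : ∀ n, 0 < h n) (hl : Tendsto h atTop (𝓝 0)) {U : ℕ → Ed d → ℝ} {u : Ed d → ℝ}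
    (hu : MeshLim d Ω h U u) : ContinuousOn u (closure Ω) := by
  intro x hx
  rw [Metric.continuousWithinAt_iff]
  intro ε hε
  obtain ⟨δ, hδ, H⟩ := hu x hx (ε / 3) (by positivity)
  refine ⟨δ, hδ, fun y hy hyx => ?_⟩
  rw [dist_eq_norm] at hyx
  obtain ⟨δ', hδ', H'⟩ := hu y hy (ε / 3) (by positivity)
  obtain ⟨n, hn, hn', z, hz, hzy⟩ := (H.and (H'.and (eventually_exists_lat_near ho hh hl hy
    (lt_min hδ' (sub_pos.mpr hyx))))).exists
  have h1 := abs_le.mp (hn' z hz (hzy.trans_le (min_le_left _ _)))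
  have h2 := hzy.trans_le (min_le_right _ _)
  have h3 := norm_add_le (z - y) (y - x)
  rw [sub_add_sub_cancel] at h3
  have h4 := abs_le.mp (hn z hz (by linarith))
  rw [Real.dist_eq, abs_lt]
  constructor <;> linarith

lemma MeshLim.tendsto {d : ℕ} {Ω : Set (Ed d)} {h : ℕ → ℝ}
    {U : ℕ → Ed d → ℝ} {u : Ed d → ℝ} (hu : MeshLim d Ω h U u) {x : Ed d} (hx : x ∈ closure Ω)
    {y : ℕ → Ed d} (hy : ∀ᶠ n in atTop, y n ∈ closure Ω ∩ lat d (h n))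
    (hyx : Tendsto y atTop (𝓝 x)) : Tendsto (fun n => U n (y n)) atTop (𝓝 (u x)) := by
  rw [Metric.tendsto_nhds]
  intro ε hε
  obtain ⟨δ, hδ, H⟩ := hu x hx (ε / 2) (half_pos hε)
  filter_upwards [H, hy, (Metric.tendsto_nhds.mp hyx) δ hδ] with n hn hyn hynx
  rw [dist_eq_norm] at hynx
  rw [Real.dist_eq]
  linarith [hn _ hyn hynx]

/-- Lattice points converging to an interior point. -/
lemma exists_lat_tendsto {d : ℕ} {Ω : Set (Ed d)} (ho : IsOpen Ω) {h : ℕ → ℝ}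
    (hh : ∀ n, 0 < h n) (hl : Tendsto h atTop (𝓝 0)) {x : Ed d} (hx : x ∈ Ω) :
    ∃ y : ℕ → Ed d, Tendsto y atTop (𝓝 x) ∧ (∀ n, y n ∈ lat d (h n)) ∧ ∀ᶠ n in atTop, y n ∈ Ω := by
  choose y hy using fun n => exists_lat_near (hh n) x
  have h1 : Tendsto (fun n => d * h n) atTop (𝓝 0) := by simpa using hl.const_mul (d : ℝ)
  have hyx : Tendsto y atTop (𝓝 x) :=
    tendsto_iff_norm_sub_tendsto_zero.mpr (squeeze_zero (fun _ => norm_nonneg _)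
      (fun n => (hy n).2) h1)
  exact ⟨y, hyx, fun n => (hy n).1, hyx.eventually (ho.mem_nhds hx)⟩

lemma eventually_mem_meshInt {d : ℕ} {Ω : Set (Ed d)} (ho : IsOpen Ω) {h : ℕ → ℝ}
    (hh : ∀ n, 0 < h n) (hl : Tendsto h atTop (𝓝 0)) {x : Ed d} (hx : x ∈ Ω) {y : ℕ → Ed d}
    (hyx : Tendsto y atTop (𝓝 x)) (hy : ∀ n, y n ∈ lat d (h n)) :
    ∀ᶠ n in atTop, y n ∈ meshInt d Ω (h n) := by
  obtain ⟨ρ, hρ, H⟩ := exists_closedBall_two_mul_subset ho hx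
  filter_upwards [hl.eventually_lt_const hρ, (Metric.tendsto_nhds.mp hyx) ρ hρ] with n hn hyn
  rw [dist_eq_norm] at hyn
  exact mem_meshInt_of_closedBall (hh n) (by linarith : h n ≤ 2 * ρ) (hy n) (H _ hyn.le)

/-- A continuous midpoint convex function on `[0, 1]` is bounded by its boundary values. -/
lemma nonpos_of_midpoint {w : ℝ → ℝ} (hw : ContinuousOn w (Set.Icc 0 1)) (h0 : w 0 ≤ 0)
    (h1 : w 1 ≤ 0) (hmid : ∀ t s, t - s ∈ Set.Icc (0 : ℝ) 1 → t + s ∈ Set.Icc (0 : ℝ) 1 →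
      2 * w t ≤ w (t + s) + w (t - s)) {t : ℝ} (ht : t ∈ Set.Icc (0 : ℝ) 1) : w t ≤ 0 := by
  obtain ⟨m, hm, hmax⟩ := isCompact_Icc.exists_isMaxOn (Set.nonempty_Icc.mpr zero_le_one) hw
  refine (hmax ht).trans ?_
  rcases le_total m (1 - m) with hle | hle
  · have hmem : m + m ∈ Set.Icc (0 : ℝ) 1 := ⟨by linarith [hm.1], by linarith⟩
    have h2 := hmid m m (by simp) hmem
    have h3 : w (m + m) ≤ w m := hmax hmem
    rw [sub_self] at h2
    linarith
  · have hmem : m - (1 - m) ∈ Set.Icc (0 : ℝ) 1 := ⟨by linarith, by linarith [hm.2]⟩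
    have h2 := hmid m (1 - m) hmem (by simp)
    have h3 : w (m - (1 - m)) ≤ w m := hmax hmem
    rw [add_sub_cancel] at h2
    linarith

/-- Limits of discrete convex functions are convex. -/
lemma MeshLim.convexOn {d : ℕ} {Ω : Set (Ed d)} (ho : IsOpen Ω) (hc : Convex ℝ Ω) {h : ℕ → ℝ}
    (hh : ∀ n, 0 < h n) (hl : Tendsto h atTop (𝓝 0)) {U : ℕ → Ed d → ℝ} {u : Ed d → ℝ}
    (hU : ∀ n, DiscConvex d Ω (h n) (U n)) (hu : MeshLim d Ω h U u) : ConvexOn ℝ Ω u := by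
  have hmid : ∀ x ∈ Ω, ∀ e : Ed d, x + e ∈ Ω → x - e ∈ Ω → 2 * u x ≤ u (x + e) + u (x - e) := by
    intro x hx e hxe hxe'
    obtain ⟨y, hyx, hy, hyΩ⟩ := exists_lat_tendsto ho hh hl hx
    obtain ⟨z, hze, hz, -⟩ := exists_lat_tendsto isOpen_univ hh hl (Set.mem_univ e)
    have h1 : ∀ᶠ n in atTop, y n ∈ closure Ω ∩ lat d (h n) :=
      hyΩ.mono fun n hn => ⟨subset_closure hn, hy n⟩
    have h2 : ∀ᶠ n in atTop, y n + z n ∈ closure Ω ∩ lat d (h n) :=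
      ((hyx.add hze).eventually (ho.mem_nhds hxe)).mono fun n hn =>
        ⟨subset_closure hn, lat_add (hy n) (hz n)⟩
    have h3 : ∀ᶠ n in atTop, y n - z n ∈ closure Ω ∩ lat d (h n) :=
      ((hyx.sub hze).eventually (ho.mem_nhds hxe')).mono fun n hn =>
        ⟨subset_closure hn, lat_sub (hy n) (hz n)⟩
    have l1 := hu.tendsto (subset_closure hx) h1 hyx
    have l2 := hu.tendsto (subset_closure hxe) h2 (hyx.add hze)
    have l3 := hu.tendsto (subset_closure hxe') h3 (hyx.sub hze)
    refine le_of_tendsto_of_tendsto (l1.const_mul 2) (l2.add l3) ?_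
    filter_upwards [h2, h3, eventually_mem_meshInt ho hh hl hx hyx hy] with n a2 a3 a1
    have := hU n (y n) a1 (z n) (hz n) a2 a3
    linarith
  have hcont := hu.continuousOn ho hh hl
  refine ⟨hc, fun x hx y hy a b ha hb hab => ?_⟩
  have hseg : ∀ t ∈ Set.Icc (0 : ℝ) 1, x + t • (y - x) ∈ Ω := fun t ht =>
    hc.add_smul_sub_mem hx hy ht
  have hw := nonpos_of_midpoint (w := fun t => u (x + t • (y - x)) - ((1 - t) * u x + t * u y))
    (t := b) ?_ ?_ ?_ ?_ ⟨hb, by linarith⟩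
  · have h1 : a • x + b • y = x + b • (y - x) := by
      rw [← eq_sub_iff_add_eq] at hab; rw [hab]; module
    have h2 : a = 1 - b := by linarith
    rw [h1, smul_eq_mul, smul_eq_mul, h2]
    linarith
  · refine ContinuousOn.sub (hcont.comp (by fun_prop) fun t ht => subset_closure (hseg t ht)) ?_
    fun_prop
  · simp
  · simp
  · intro t s h1 h2
    have ht : t ∈ Set.Icc (0 : ℝ) 1 :=
      ⟨by linarith [h1.1, h2.1], by linarith [h1.2, h2.2]⟩
    have e1 : x + (t + s) • (y - x) = x + t • (y - x) + s • (y - x) := by module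
    have e2 : x + (t - s) • (y - x) = x + t • (y - x) - s • (y - x) := by module
    have h3 := hmid _ (hseg t ht) (s • (y - x)) (e1 ▸ hseg _ h2) (e2 ▸ hseg _ h1)
    rw [← e1, ← e2] at h3
    linarith

lemma MeshLim.eq_of_mem_frontier {d : ℕ} (hd : 0 < d) {Ω : Set (Ed d)} (ho : IsOpen Ω)
    (hc : Convex ℝ Ω) (hb : Bornology.IsBounded Ω) {g : Ed d → ℝ}
    (hg : ContinuousOn g (closure Ω)) (hgc : ConvexOn ℝ Ω g) {A : ℝ} {i : ℕ} {h : ℕ → ℝ}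
    (hh : ∀ n, 0 < h n) (hl : Tendsto h atTop (𝓝 0)) {F U : ℕ → Ed d → ℝ}
    (hs : ∀ n, MeshSol i d Ω g A (h n) (F n) (U n)) {u : Ed d → ℝ} (hu : MeshLim d Ω h U u)
    {x : Ed d} (hx : x ∈ frontier Ω) : u x = g x := by
  refine eq_of_forall_dist_le fun ε hε => ?_
  obtain ⟨δ, hδ, H⟩ := exists_boundary_modulus hd ho hc hb hg hgc A hx (half_pos hε)
  have hxc := frontier_subset_closure hx
  obtain ⟨δ', hδ', H'⟩ := hu x hxc (ε / 2) (half_pos hε)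
  obtain ⟨n, hn, y, hy, hyx⟩ := (H'.and (eventually_exists_lat_near ho hh hl hxc
    (lt_min hδ hδ'))).exists
  have h1 := abs_le.mp (H i _ _ _ (hh n) (hs n) y hy (hyx.trans_le (min_le_left _ _)))
  have h2 := abs_le.mp (hn y hy (hyx.trans_le (min_le_right _ _)))
  rw [Real.dist_eq, abs_le]
  constructor <;> linarith

/-- Uniform convergence on the closure. -/
lemma MeshLim.eventually_abs_sub_lt {d : ℕ} {Ω : Set (Ed d)} (ho : IsOpen Ω)
    (hb : Bornology.IsBounded Ω) {h : ℕ → ℝ} (hh : ∀ n, 0 < h n) (hl : Tendsto h atTop (𝓝 0))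
    {U : ℕ → Ed d → ℝ} {u : Ed d → ℝ} (hu : MeshLim d Ω h U u) {ε : ℝ} (hε : 0 < ε) :
    ∀ᶠ n in atTop, ∀ y ∈ closure Ω ∩ lat d (h n), |U n y - u y| < ε := by
  by_contra hcon
  rw [not_eventually] at hcon
  obtain ⟨φ, hφ, hfr⟩ := extraction_of_frequently_atTop hcon
  push Not at hfr
  choose y hy hyε using hfr
  obtain ⟨x, hx, ψ, hψ, hlim⟩ := (hb.isCompact_closure).tendsto_subseq fun n => (hy n).1
  have hu' := (hu.comp_strictMono hφ).comp_strictMono hψ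
  have l1 := hu'.tendsto hx (y := y ∘ ψ) (Eventually.of_forall fun n => hy (ψ n)) hlim
  have l2 : Tendsto (fun n => u (y (ψ n))) atTop (𝓝 (u x)) :=
    (hu.continuousOn ho hh hl x hx).tendsto.comp (tendsto_nhdsWithin_iff.mpr
      ⟨hlim, Eventually.of_forall fun n => (hy (ψ n)).1⟩)
  have l3 := (l1.sub l2).abs
  rw [sub_self, abs_zero] at l3
  obtain ⟨n, hn⟩ := (l3.eventually_lt_const hε).exists
  exact (hyε (ψ n)).not_gt hn

lemma exists_pos_closedBall_subset_of_isCompact {d : ℕ} {Ω K : Set (Ed d)} (ho : IsOpen Ω)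
    (hK : IsCompact K) (hKΩ : K ⊆ Ω) : ∃ ρ > 0, Metric.cthickening ρ K ⊆ Ω ∧
      ∀ x ∈ Metric.cthickening ρ K, Metric.closedBall x (2 * ρ) ⊆ Ω := by
  obtain ⟨r, hr, hrΩ⟩ := hK.exists_cthickening_subset_open ho hKΩ
  refine ⟨r / 3, by positivity, (Metric.cthickening_mono (by linarith) K).trans hrΩ,
    fun x hx => ?_⟩
  have h1 := (Metric.closedBall_subset_cthickening hx (2 * (r / 3))).trans
    (Metric.cthickening_cthickening_subset (by positivity) (by positivity) K)
  refine h1.trans ((Metric.cthickening_mono (by linarith) K).trans hrΩ)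

/-- Limits of discrete subgradients are subgradients. -/
lemma MeshLim.mem_nmap_of_tendsto {d : ℕ} {Ω : Set (Ed d)} (ho : IsOpen Ω) (hc : Convex ℝ Ω)
    (hb : Bornology.IsBounded Ω) {h : ℕ → ℝ} (hh : ∀ n, 0 < h n) (hl : Tendsto h atTop (𝓝 0))
    {U : ℕ → Ed d → ℝ} {u : Ed d → ℝ} (hu : MeshLim d Ω h U u) {C : ℝ} (hC : 0 < C)
    (hU : ∀ n, DiscConvex d Ω (h n) (U n)) (hbd : ∀ n, ∀ x ∈ closure Ω ∩ lat d (h n), |U n x| ≤ C)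
    {x p : ℕ → Ed d} {x₀ p₀ : Ed d} (hx₀ : x₀ ∈ Ω) (hx : ∀ n, x n ∈ lat d (h n))
    (hxl : Tendsto x atTop (𝓝 x₀)) (hp : ∀ n, p n ∈ subdiff1 d Ω (h n) (U n) (x n))
    (hpl : Tendsto p atTop (𝓝 p₀)) : p₀ ∈ nmap d Ω u x₀ := by
  intro z hz
  obtain ⟨ρ₁, hρ₁, B₁⟩ := exists_closedBall_two_mul_subset ho hx₀
  obtain ⟨ρ₂, hρ₂, B₂⟩ := exists_closedBall_two_mul_subset ho hz
  obtain ⟨y, hyl, hy, -⟩ := exists_lat_tendsto ho hh hl hz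
  obtain ⟨K, hK, H⟩ := exists_approx_subgradient hc hb hC (lt_min hρ₁ hρ₂)
  obtain ⟨h₀, hh₀, H⟩ := H 1 one_pos
  have e1 : ∀ᶠ n in atTop, ‖x n - x₀‖ ≤ ρ₁ :=
    ((Metric.tendsto_nhds.mp hxl) ρ₁ hρ₁).mono fun n hn => (dist_eq_norm (x n) x₀).symm.trans_le hn.le
  have e2 : ∀ᶠ n in atTop, ‖y n - z‖ ≤ ρ₂ :=
    ((Metric.tendsto_nhds.mp hyl) ρ₂ hρ₂).mono fun n hn => (dist_eq_norm (y n) z).symm.trans_le hn.le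
  have s1 : ∀ x : Ed d, Metric.closedBall x (2 * min ρ₁ ρ₂) ⊆ Metric.closedBall x (2 * ρ₁) := fun x =>
    Metric.closedBall_subset_closedBall (by linarith [min_le_left ρ₁ ρ₂])
  have s2 : ∀ x : Ed d, Metric.closedBall x (2 * min ρ₁ ρ₂) ⊆ Metric.closedBall x (2 * ρ₂) := fun x =>
    Metric.closedBall_subset_closedBall (by linarith [min_le_right ρ₁ ρ₂])
  have l1 := hu.tendsto (subset_closure hx₀) ((hxl.eventually (ho.mem_nhds hx₀)).mono
    fun n hn => ⟨subset_closure hn, hx n⟩) hxl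
  have l2 := hu.tendsto (subset_closure hz) ((hyl.eventually (ho.mem_nhds hz)).mono
    fun n hn => ⟨subset_closure hn, hy n⟩) hyl
  have l0 : Tendsto (fun n => √(h n)) atTop (𝓝 √0) :=
    (Real.continuous_sqrt.tendsto 0).comp hl
  have l3 : Tendsto (fun n => U n (x n) + ⟪p n, y n - x n⟫ - K * ‖y n - x n‖ * √(h n) / 1) atTop
      (𝓝 (u x₀ + ⟪p₀, z - x₀⟫ - K * ‖z - x₀‖ * √0 / 1)) :=
    (l1.add (hpl.inner (hyl.sub hxl))).sub
      ((((hyl.sub hxl).norm.const_mul K).mul l0).div_const 1)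
  rw [Real.sqrt_zero, mul_zero, zero_div, sub_zero] at l3
  refine le_of_tendsto_of_tendsto l3 l2 ?_
  filter_upwards [e1, e2, hl.eventually_lt_const hh₀] with n h1 h2 h3
  exact (H (h n) (U n) (hh n) h3 (hU n) (hbd n) (x n) (hx n) (y n) (hy n)
    ((s1 _).trans (B₁ _ h1)) ((s2 _).trans (B₂ _ h2)) (p n) (hp n)).2

lemma nmapSet_mono {d : ℕ} {Ω : Set (Ed d)} {u : Ed d → ℝ} {s t : Set (Ed d)} (h : s ⊆ t) :
    nmapSet d Ω u s ⊆ nmapSet d Ω u t := Set.biUnion_subset_biUnion_left h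

lemma mem_nmapSet {d : ℕ} {Ω : Set (Ed d)} {u : Ed d → ℝ} {s : Set (Ed d)} {p : Ed d} :
    p ∈ nmapSet d Ω u s ↔ ∃ x ∈ s, p ∈ nmap d Ω u x := by simp [nmapSet]

lemma isCompact_nmapSet {d : ℕ} {Ω : Set (Ed d)} (ho : IsOpen Ω) {u : Ed d → ℝ}
    (hu : ContinuousOn u Ω) {K : Set (Ed d)} (hK : IsCompact K) (hKΩ : K ⊆ Ω) :
    IsCompact (nmapSet d Ω u K) := by
  obtain ⟨ρ, hρ, hρΩ, -⟩ := exists_pos_closedBall_subset_of_isCompact ho hK hKΩ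
  obtain ⟨C, hC⟩ := (hK.cthickening (r := ρ)).exists_bound_of_continuousOn (hu.mono hρΩ)
  have hbdd : ∀ x ∈ K, ∀ p ∈ nmap d Ω u x, ‖p‖ ≤ 2 * C / ρ := by
    intro x hx p hp
    have hxm : x ∈ Metric.cthickening ρ K := Metric.self_subset_cthickening K hx
    have hx1 := abs_le.mp (hC x hxm)
    rcases eq_or_ne p 0 with rfl | hp0
    · rw [norm_zero]
      have : 0 ≤ C := (abs_nonneg _).trans (hC x hxm)
      positivity
    have hpn : 0 < ‖p‖ := norm_pos_iff.mpr hp0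
    have hz : x + (ρ / ‖p‖) • p ∈ Metric.cthickening ρ K := by
      refine Metric.closedBall_subset_cthickening hx ρ ?_
      rw [mem_closedBall_iff_norm, add_sub_cancel_left, norm_smul, Real.norm_eq_abs, abs_of_pos
        (by positivity), div_mul_cancel₀ _ hpn.ne']
    have h1 := hp _ (hρΩ hz)
    have h2 := abs_le.mp (hC _ hz)
    rw [add_sub_cancel_left, real_inner_smul_right, real_inner_self_eq_norm_sq] at h1
    have h3 : ρ / ‖p‖ * ‖p‖ ^ 2 = ρ * ‖p‖ := by field_simp
    rw [le_div_iff₀ hρ]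
    linarith
  refine IsSeqCompact.isCompact fun p hp => ?_
  choose x hxK hpx using fun n => mem_nmapSet.mp (hp n)
  obtain ⟨x₀, hx₀, φ, hφ, hxl⟩ := hK.tendsto_subseq hxK
  obtain ⟨p₀, -, ψ, hψ, hpl⟩ := (isCompact_closedBall (0 : Ed d) (2 * C / ρ)).tendsto_subseq
    (x := p ∘ φ) fun n => by
      rw [mem_closedBall_zero_iff]; exact hbdd _ (hxK (φ n)) _ (hpx (φ n))
  refine ⟨p₀, mem_nmapSet.mpr ⟨x₀, hx₀, fun z hz => ?_⟩, φ ∘ ψ, hφ.comp hψ, hpl⟩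
  have hxl' : Tendsto (fun n => x (φ (ψ n))) atTop (𝓝 x₀) := hxl.comp hψ.tendsto_atTop
  have l1 : Tendsto (fun n => u (x (φ (ψ n)))) atTop (𝓝 (u x₀)) :=
    (hu.continuousAt (ho.mem_nhds (hKΩ hx₀))).tendsto.comp hxl'
  refine le_of_tendsto (l1.add (hpl.inner (tendsto_const_nhds.sub hxl')))
    (Eventually.of_forall fun n => hpx (φ (ψ n)) z hz)

/-- Discrete normal images near a compact set concentrate near the normal image of the limit. -/
lemma MeshLim.exists_eventually_subset_thickening {d : ℕ} {Ω : Set (Ed d)} (ho : IsOpen Ω)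
    (hc : Convex ℝ Ω) (hb : Bornology.IsBounded Ω) {h : ℕ → ℝ} (hh : ∀ n, 0 < h n)
    (hl : Tendsto h atTop (𝓝 0)) {U : ℕ → Ed d → ℝ} {u : Ed d → ℝ} (hu : MeshLim d Ω h U u)
    {C : ℝ} (hC : 0 < C) (hU : ∀ n, DiscConvex d Ω (h n) (U n))
    (hbd : ∀ n, ∀ x ∈ closure Ω ∩ lat d (h n), |U n x| ≤ C) {K : Set (Ed d)} (hK : IsCompact K)
    (hKΩ : K ⊆ Ω) {δ : ℝ} (hδ : 0 < δ) : ∃ t > 0, ∀ᶠ n in atTop,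
      ∀ x ∈ Metric.cthickening t K ∩ lat d (h n),
        subdiff1 d Ω (h n) (U n) x ⊆ Metric.thickening δ (nmapSet d Ω u K) := by
  obtain ⟨ρ, hρ, -, hball⟩ := exists_pos_closedBall_subset_of_isCompact ho hK hKΩ
  by_contra hcon
  push Not at hcon
  have hfr : ∀ m : ℕ, ∃ᶠ n in atTop, ∃ x ∈ Metric.cthickening (ρ / (m + 1)) K ∩ lat d (h n),
      (∃ p ∈ subdiff1 d Ω (h n) (U n) x, p ∉ Metric.thickening δ (nmapSet d Ω u K)) ∧
        h n ≤ ρ := fun m => by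
    have h1 := (hcon (ρ / (m + 1)) (by positivity)).and_eventually (hl.eventually_lt_const hρ)
    refine h1.mono ?_
    rintro n ⟨⟨x, hx, hp⟩, hn⟩
    exact ⟨x, hx, Set.not_subset.mp hp, hn.le⟩
  obtain ⟨φ, hφ, H⟩ := extraction_forall_of_frequently hfr
  choose x hx hp hhρ using H
  choose p hp hpδ using hp
  have hxρ : ∀ m, x m ∈ Metric.cthickening ρ K := fun m =>
    Metric.cthickening_mono (div_le_self hρ.le (by
      have : (0 : ℝ) ≤ m := m.cast_nonneg
      linarith)) K (hx m).1
  have hpn : ∀ m, p m ∈ Metric.closedBall (0 : Ed d) (d * (4 * C / ρ)) := fun m => by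
    rw [mem_closedBall_zero_iff]
    exact norm_le_of_mem_subdiff1 (hU _) (hh _) hC (hbd _) (hhρ m) (hx m).2 (hball _ (hxρ m)) (hp m)
  obtain ⟨x₀, -, ψ, hψ, hxl⟩ := hK.cthickening.tendsto_subseq hxρ
  obtain ⟨p₀, -, χ, hχ, hpl⟩ := (isCompact_closedBall _ _).tendsto_subseq fun n => hpn (ψ n)
  have hxl' : Tendsto (fun n => x (ψ (χ n))) atTop (𝓝 x₀) := hxl.comp hχ.tendsto_atTop
  have hx₀ : x₀ ∈ K := by
    rw [← hK.isClosed.closure_eq, Metric.closure_eq_iInter_cthickening]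
    refine Set.mem_iInter₂.mpr fun ε hε => ?_
    have l : Tendsto (fun m : ℕ => ρ / ((ψ (χ m) : ℕ) + 1 : ℝ)) atTop (𝓝 0) := by
      have h1 : Tendsto (fun m : ℕ => ρ / ((m : ℝ) + 1)) atTop (𝓝 0) := by
        have := tendsto_one_div_add_atTop_nhds_zero_nat (𝕜 := ℝ)
        have := this.const_mul ρ
        simpa only [mul_one_div, mul_zero] using this
      exact h1.comp (hψ.comp hχ).tendsto_atTop
    refine Metric.isClosed_cthickening.mem_of_tendsto hxl' ?_
    filter_upwards [l.eventually_le_const hε] with n hn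
    exact Metric.cthickening_mono hn K (hx _).1
  have hmono := hφ.comp (hψ.comp hχ)
  have hp₀ := (hu.comp_strictMono hmono).mem_nmap_of_tendsto ho hc hb (fun n => hh _)
    (hl.comp hmono.tendsto_atTop) hC (fun n => hU _) (fun n => hbd _) (hKΩ hx₀)
    (x := fun n => x (ψ (χ n))) (p := fun n => p (ψ (χ n))) (fun n => (hx _).2) hxl'
    (fun n => hp _) hpl
  have hmem : p₀ ∈ Metric.thickening δ (nmapSet d Ω u K) :=
    Metric.self_subset_thickening hδ _ (mem_nmapSet.mpr ⟨x₀, hx₀, hp₀⟩)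
  obtain ⟨n, hn⟩ := (hpl.eventually (Metric.isOpen_thickening.mem_nhds hmem)).exists
  exact hpδ _ hn

/-- Total discrete Monge-Ampere mass over an interior set is bounded by the volume of any set
containing slightly sheared discrete normal images. -/
lemma sum_volume_le_of_disjoint {d : ℕ} {S : Ed d → Set (Ed d)} (hS : ∀ x, IsClosed (S x))
    {N : Set (Ed d)} (F : Finset (Ed d)) {lam : ℝ}
    (hdisj : ∀ x ∈ F, ∀ y ∈ F, x ≠ y → ∀ p ∈ S x, ∀ q ∈ S y, p + lam • x ≠ q + lam • y)
    (hsub : ∀ x ∈ F, ∀ p ∈ S x, p + lam • x ∈ N) : ∑ x ∈ F, volume (S x) ≤ volume N := by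
  have h1 : ∀ x, volume ((fun p => p + -(lam • x)) ⁻¹' S x) = volume (S x) := fun x =>
    measure_preimage_add_right volume _ _
  rw [← Finset.sum_congr rfl fun x _ => h1 x, ← measure_biUnion_finset]
  · refine measure_mono (Set.iUnion₂_subset fun x hx p hp => ?_)
    have := hsub x hx _ hp
    rwa [neg_add_cancel_right] at this
  · intro x hx y hy hxy
    refine Set.disjoint_left.mpr fun p hp hq => hdisj x hx y hy hxy _ hp _ hq ?_
    rw [neg_add_cancel_right, neg_add_cancel_right]
  · exact fun x _ => ((hS x).preimage (by fun_prop)).measurableSet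

/-- The limit measure of a compact set is bounded by the volume of the normal image. -/
lemma MeshLim.measure_le_volume_nmapSet {d : ℕ} {Ω : Set (Ed d)} (ho : IsOpen Ω)
    (hc : Convex ℝ Ω) (hb : Bornology.IsBounded Ω) {h : ℕ → ℝ} (hh : ∀ n, 0 < h n)
    (hl : Tendsto h atTop (𝓝 0)) {i : ℕ} {g : Ed d → ℝ} {A : ℝ} {F U : ℕ → Ed d → ℝ}
    (hs : ∀ n, MeshSol i d Ω g A (h n) (F n) (U n)) {u : Ed d → ℝ} (hu : MeshLim d Ω h U u)
    {C : ℝ} (hC : 0 < C) (hbd : ∀ n, ∀ x ∈ closure Ω ∩ lat d (h n), |U n x| ≤ C)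
    {ν : Measure (Ed d)} [IsFiniteMeasure ν]
    (hw : ∀ B ⊆ Ω, MeasurableSet B → ν (frontier B ∩ Ω) = 0 →
      Tendsto (fun n => h n ^ d * ∑' x : (B ∩ meshInt d Ω (h n) : Set (Ed d)), F n x) atTop
        (𝓝 (ν B).toReal)) {K : Set (Ed d)} (hK : IsCompact K) (hKΩ : K ⊆ Ω) :
    ν K ≤ volume (nmapSet d Ω u K) := by
  have hU := fun n => (hs n).conv
  have hcpt := isCompact_nmapSet ho ((hu.continuousOn ho hh hl).mono subset_closure) hK hKΩ
  obtain ⟨ρ, hρ, hρΩ, hball⟩ := exists_pos_closedBall_subset_of_isCompact ho hK hKΩ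
  obtain ⟨R, hR⟩ := hb.exists_norm_le
  set R' := |R| + 1 with hR'
  have hR'0 : 0 < R' := by positivity
  have key : ∀ δ > 0, ν K ≤ volume (Metric.cthickening δ (nmapSet d Ω u K)) := by
    intro δ hδ
    obtain ⟨t, ht, Ht⟩ := hu.exists_eventually_subset_thickening ho hc hb hh hl hC hU hbd hK hKΩ
      (half_pos hδ)
    obtain ⟨rs, hrs, hrs'⟩ := exists_null_frontiers_thickening ν K
    obtain ⟨m, hm⟩ := (hrs.eventually_lt_const (lt_min ht hρ)).exists
    obtain ⟨hr0, hr⟩ := hrs' m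
    set V := Metric.thickening (rs m) K with hV
    have hVt : V ⊆ Metric.cthickening t K := (Metric.thickening_subset_cthickening _ _).trans
      (Metric.cthickening_mono (hm.le.trans (min_le_left _ _)) K)
    have hVρ : V ⊆ Metric.cthickening ρ K := (Metric.thickening_subset_cthickening _ _).trans
      (Metric.cthickening_mono (hm.le.trans (min_le_right _ _)) K)
    have hlim := hw V (hVρ.trans hρΩ) Metric.isOpen_thickening.measurableSet
      (measure_mono_null Set.inter_subset_left hr)
    obtain ⟨h₀, hh₀, Hd⟩ := exists_sheared_disjoint hc hb hC hρ
      (show 0 < δ / (2 * R') by positivity)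
    refine (measure_mono (Metric.self_subset_thickening hr0 K)).trans ?_
    have hlim' := ENNReal.tendsto_ofReal hlim
    rw [ENNReal.ofReal_toReal (measure_ne_top ν _)] at hlim'
    refine le_of_tendsto hlim' ?_
    filter_upwards [Ht, hl.eventually_lt_const hh₀] with n hn hn0
    rw [← (hs n).sum_volume hb (hh n) V]
    have hF : ∀ x ∈ (inter_meshInt_finite hb (hh n) V).toFinset, x ∈ V ∧ x ∈ meshInt d Ω (h n) :=
      fun x hx => by simpa using hx
    refine sum_volume_le_of_disjoint (fun x => isClosed_subdiffI) _ (lam := δ / (2 * R')) ?_ ?_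
    · intro x hx y hy hxy p hp q hq
      obtain ⟨hxV, hxm⟩ := hF x hx
      obtain ⟨hyV, hym⟩ := hF y hy
      exact Hd (h n) (U n) (hh n) hn0 (hU n) (hbd n) x hxm.1.2 y hym.1.2 (hball x (hVρ hxV))
        (hball y (hVρ hyV)) hxy p (subdiffI_subset_subdiff1 hp) q (subdiffI_subset_subdiff1 hq)
    · intro x hx p hp
      obtain ⟨hxV, hxm⟩ := hF x hx
      have h1 := hn x ⟨hVt hxV, hxm.1.2⟩ (subdiffI_subset_subdiff1 hp)
      obtain ⟨q, hq, hpq⟩ := Metric.mem_thickening_iff.mp h1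
      refine Metric.mem_cthickening_of_dist_le _ q δ _ hq ?_
      have h2 : ‖(δ / (2 * R')) • x‖ ≤ δ / 2 := by
        rw [norm_smul, Real.norm_eq_abs, abs_of_pos (by positivity)]
        have : ‖x‖ ≤ R' := (hR x hxm.1.1).trans (by rw [hR']; linarith [le_abs_self R])
        calc δ / (2 * R') * ‖x‖ ≤ δ / (2 * R') * R' := by gcongr
          _ = δ / 2 := by field_simp
      have h3 := dist_triangle (p + (δ / (2 * R')) • x) p q
      rw [dist_eq_norm (p + _) p, add_sub_cancel_left] at h3
      linarith
  have hlim := (tendsto_measure_cthickening_of_isCompact (μ := (volume : Measure (Ed d)))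
    hcpt).mono_left (nhdsWithin_le_nhds (s := Set.Ioi 0))
  exact ge_of_tendsto hlim (eventually_nhdsWithin_of_forall fun δ hδ => key δ hδ)

/-- The Legendre transform over the closure of `Ω`. -/
def legendre (d : ℕ) (Ω : Set (Ed d)) (u : Ed d → ℝ) (p : Ed d) : ℝ :=
  sSup ((fun x => ⟪p, x⟫ - u x) '' closure Ω)

lemma sub_le_legendre {d : ℕ} {Ω : Set (Ed d)} (hb : Bornology.IsBounded Ω) {u : Ed d → ℝ}
    (hu : ContinuousOn u (closure Ω)) {x : Ed d} (hx : x ∈ closure Ω) (p : Ed d) :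
    ⟪p, x⟫ - u x ≤ legendre d Ω u p :=
  le_csSup (hb.isCompact_closure.bddAbove_image (by fun_prop)) (Set.mem_image_of_mem _ hx)

lemma exists_legendre_eq {d : ℕ} {Ω : Set (Ed d)} (hb : Bornology.IsBounded Ω) (hne : Ω.Nonempty)
    {u : Ed d → ℝ} (hu : ContinuousOn u (closure Ω)) (p : Ed d) :
    ∃ x ∈ closure Ω, legendre d Ω u p = ⟪p, x⟫ - u x := by
  obtain ⟨x, hx, h⟩ := hb.isCompact_closure.exists_sSup_image_eq hne.closure
    (f := fun x => ⟪p, x⟫ - u x) (by fun_prop)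
  exact ⟨x, hx, h⟩

lemma exists_lipschitzWith_legendre {d : ℕ} {Ω : Set (Ed d)} (hb : Bornology.IsBounded Ω)
    (hne : Ω.Nonempty) {u : Ed d → ℝ} (hu : ContinuousOn u (closure Ω)) :
    ∃ C, LipschitzWith C (legendre d Ω u) := by
  obtain ⟨R, hR⟩ := hb.closure.exists_norm_le
  refine ⟨R.toNNReal, LipschitzWith.of_le_add_mul' R fun p q => ?_⟩
  obtain ⟨x, hx, h⟩ := exists_legendre_eq hb hne hu p
  have h1 := sub_le_legendre hb hu hx q
  have h2 : ⟪p - q, x⟫ ≤ ‖p - q‖ * ‖x‖ := real_inner_le_norm _ _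
  have h3 : ‖p - q‖ * ‖x‖ ≤ ‖p - q‖ * R := by gcongr; exact hR x hx
  rw [inner_sub_left] at h2
  rw [dist_eq_norm]
  linarith

/-- At points of differentiability the maximizer is the gradient of the Legendre transform. -/
lemma fderiv_legendre_eq {d : ℕ} {Ω : Set (Ed d)} (hb : Bornology.IsBounded Ω) {u : Ed d → ℝ}
    (hu : ContinuousOn u (closure Ω)) {p x : Ed d} (hp : DifferentiableAt ℝ (legendre d Ω u) p)
    (hx : x ∈ closure Ω) (hpx : legendre d Ω u p = ⟪p, x⟫ - u x) :
    fderiv ℝ (legendre d Ω u) p = innerSL ℝ x := by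
  have hmin : IsLocalMin (fun q => legendre d Ω u q - innerSL ℝ x q) p := by
    refine Eventually.of_forall fun q => ?_
    have h1 := sub_le_legendre hb hu hx q
    simp only [innerSL_apply_apply]
    rw [hpx, real_inner_comm, real_inner_comm q x]
    linarith
  have h1 := hmin.fderiv_eq_zero
  have h2 : HasFDerivAt (fun q => legendre d Ω u q - innerSL ℝ x q)
      (fderiv ℝ (legendre d Ω u) p - innerSL ℝ x) p :=
    hp.hasFDerivAt.sub (innerSL ℝ x).hasFDerivAt
  rw [h2.fderiv] at h1
  exact sub_eq_zero.mp h1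

lemma eq_of_legendre_eq {d : ℕ} {Ω : Set (Ed d)} (hb : Bornology.IsBounded Ω) {u : Ed d → ℝ}
    (hu : ContinuousOn u (closure Ω)) {p x y : Ed d}
    (hp : DifferentiableAt ℝ (legendre d Ω u) p) (hx : x ∈ closure Ω) (hy : y ∈ closure Ω)
    (hpx : legendre d Ω u p = ⟪p, x⟫ - u x) (hpy : legendre d Ω u p = ⟪p, y⟫ - u y) : x = y := by
  have h := (fderiv_legendre_eq hb hu hp hx hpx).symm.trans (fderiv_legendre_eq hb hu hp hy hpy)
  refine ext_inner_right ℝ fun v => ?_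
  have := congrArg (fun L => L v) h
  simpa only [innerSL_apply_apply] using this

lemma mem_nmap_closure {d : ℕ} {Ω : Set (Ed d)} {u : Ed d → ℝ}
    (hu : ContinuousOn u (closure Ω)) {p x y : Ed d} (hp : p ∈ nmap d Ω u x) (hy : y ∈ closure Ω) :
    u x + ⟪p, y - x⟫ ≤ u y := by
  obtain ⟨z, hz, hzl⟩ := mem_closure_iff_seq_limit.mp hy
  have l1 : Tendsto (fun n => u (z n)) atTop (𝓝 (u y)) := (hu y hy).tendsto.comp
    (tendsto_nhdsWithin_iff.mpr ⟨hzl, Eventually.of_forall fun n => subset_closure (hz n)⟩)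
  refine le_of_tendsto_of_tendsto (tendsto_const_nhds.add
    (tendsto_const_nhds.inner (hzl.sub tendsto_const_nhds))) l1
    (Eventually.of_forall fun n => hp _ (hz n))

lemma mem_nmap_iff_legendre {d : ℕ} {Ω : Set (Ed d)} (hb : Bornology.IsBounded Ω) {u : Ed d → ℝ}
    (hu : ContinuousOn u (closure Ω)) {p x : Ed d} (hx : x ∈ Ω) :
    p ∈ nmap d Ω u x ↔ legendre d Ω u p = ⟪p, x⟫ - u x := by
  constructor
  · intro hp
    obtain ⟨y, hy, h⟩ := exists_legendre_eq hb ⟨x, hx⟩ hu p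
    have h1 := mem_nmap_closure hu hp hy
    have h2 := sub_le_legendre hb hu (subset_closure hx) p
    rw [inner_sub_right] at h1
    linarith
  · intro hp z hz
    have h1 := sub_le_legendre hb hu (subset_closure hz) p
    rw [inner_sub_right]
    linarith

lemma volume_eventually_mem_le {d : ℕ} {T : ℕ → Set (Ed d)} {a : ℕ → ℝ≥0∞} {b : ℝ≥0∞}
    (hT : ∀ n, volume (T n) ≤ a n) (ha : Tendsto a atTop (𝓝 b)) :
    volume {p | ∀ᶠ n in atTop, p ∈ T n} ≤ b := by
  have h1 : {p | ∀ᶠ n in atTop, p ∈ T n} = ⋃ N : ℕ, {p | ∀ n ≥ N, p ∈ T n} := by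
    ext p; simp [eventually_atTop]
  have hmono : Monotone fun N : ℕ => {p | ∀ n ≥ N, p ∈ T n} :=
    fun M N hMN p hp n hn => hp n (hMN.trans hn)
  rw [h1, hmono.measure_iUnion]
  refine iSup_le fun N => ge_of_tendsto ha ?_
  filter_upwards [eventually_ge_atTop N] with n hn
  exact (measure_mono fun p (hp : ∀ n ≥ N, p ∈ T n) => hp n hn).trans (hT n)

/-- Subgradients of the limit at which the Legendre transform is differentiable are eventually
discrete subgradients at nearby mesh points. -/
lemma MeshLim.eventually_mem_biUnion {d : ℕ} {Ω : Set (Ed d)} (ho : IsOpen Ω)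
    (hb : Bornology.IsBounded Ω) {h : ℕ → ℝ} (hh : ∀ n, 0 < h n)
    (hl : Tendsto h atTop (𝓝 0)) (i : ℕ) {U : ℕ → Ed d → ℝ} {u : Ed d → ℝ}
    (hu : MeshLim d Ω h U u) {V : Set (Ed d)} (hV : IsOpen V) {x₀ p : Ed d} (hx₀ : x₀ ∈ Ω)
    (hx₀V : x₀ ∈ V) (hp : p ∈ nmap d Ω u x₀) (hpd : DifferentiableAt ℝ (legendre d Ω u) p) :
    ∀ᶠ n in atTop, p ∈ ⋃ x ∈ V ∩ meshInt d Ω (h n), subdiffI i d Ω (h n) (U n) x := by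
  have hcont := hu.continuousOn ho hh hl
  have hx₀c := subset_closure hx₀
  by_contra hcon
  rw [not_eventually] at hcon
  have hcon := hcon.and_eventually (eventually_exists_lat_near ho hh hl hx₀c one_pos)
  obtain ⟨φ, hφ, H⟩ := extraction_of_frequently_atTop hcon
  have hmin : ∀ n, ∃ y ∈ closure Ω ∩ lat d (h (φ n)), ∀ z ∈ closure Ω ∩ lat d (h (φ n)),
      U (φ n) y - ⟪p, y⟫ ≤ U (φ n) z - ⟪p, z⟫ := fun n => by
    obtain ⟨y, hy, -⟩ := (H n).2
    exact (lat_inter_finite (hh (φ n)) hb.closure).exists_minimalFor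
      (fun z => U (φ n) z - ⟪p, z⟫) _ ⟨y, hy⟩ |>.imp fun y hy => ⟨hy.1, fun z hz => by
        rcases le_total (U (φ n) y - ⟪p, y⟫) (U (φ n) z - ⟪p, z⟫) with h1 | h1
        · exact h1
        · exact hy.2 hz h1⟩
  choose y hy hymin using hmin
  have hyV : ∀ n, y n ∉ V ∩ meshInt d Ω (h (φ n)) := fun n hn =>
    (H n).1 (Set.mem_biUnion hn (mem_subdiffI_of_forall fun z hz => by
      have := hymin n z hz
      rw [inner_sub_right]; linarith))
  obtain ⟨y₀, hy₀, ψ, hψ, hyl⟩ := hb.isCompact_closure.tendsto_subseq fun n => (hy n).1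
  have hmono := hφ.comp hψ
  have hu' := hu.comp_strictMono hmono
  have hl' : Tendsto (h ∘ φ ∘ ψ) atTop (𝓝 0) := hl.comp hmono.tendsto_atTop
  obtain ⟨z, hzl, hz, hzΩ⟩ := exists_lat_tendsto ho (h := h ∘ φ ∘ ψ) (fun n => hh _) hl' hx₀
  have hzc : ∀ᶠ n in atTop, z n ∈ closure Ω ∩ lat d (h (φ (ψ n))) :=
    hzΩ.mono fun n hn => ⟨subset_closure hn, hz n⟩
  have l1 := hu'.tendsto hy₀ (Eventually.of_forall fun n => hy (ψ n)) hyl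
  have l2 := hu'.tendsto hx₀c hzc hzl
  have h1 : u y₀ - ⟪p, y₀⟫ ≤ u x₀ - ⟪p, x₀⟫ := by
    refine le_of_tendsto_of_tendsto (l1.sub (tendsto_const_nhds.inner hyl))
      (l2.sub (tendsto_const_nhds.inner hzl)) ?_
    filter_upwards [hzc] with n hn
    exact hymin (ψ n) (z n) hn
  have h2 := (mem_nmap_iff_legendre hb hcont hx₀).mp hp
  have h3 := sub_le_legendre hb hcont hy₀ p
  have h4 : y₀ = x₀ := eq_of_legendre_eq hb hcont hpd hy₀ hx₀c (by linarith) h2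
  rw [h4] at hyl
  obtain ⟨n, hn1, hn2⟩ := ((hyl.eventually (hV.mem_nhds hx₀V)).and
    (eventually_mem_meshInt ho (h := h ∘ φ ∘ ψ) (fun n => hh _) hl' hx₀ hyl
      fun n => (hy (ψ n)).2)).exists
  exact hyV (ψ n) ⟨hn1, hn2⟩

/-- The volume of the normal image of a compact set is bounded by the limit measure. -/
lemma MeshLim.volume_nmapSet_le {d : ℕ} {Ω : Set (Ed d)} (ho : IsOpen Ω)
    (hb : Bornology.IsBounded Ω) (hne : Ω.Nonempty) {h : ℕ → ℝ} (hh : ∀ n, 0 < h n)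
    (hl : Tendsto h atTop (𝓝 0)) {i : ℕ} {g : Ed d → ℝ} {A : ℝ} {F U : ℕ → Ed d → ℝ}
    (hs : ∀ n, MeshSol i d Ω g A (h n) (F n) (U n)) {u : Ed d → ℝ} (hu : MeshLim d Ω h U u)
    {ν : Measure (Ed d)} [IsFiniteMeasure ν]
    (hw : ∀ B ⊆ Ω, MeasurableSet B → ν (frontier B ∩ Ω) = 0 →
      Tendsto (fun n => h n ^ d * ∑' x : (B ∩ meshInt d Ω (h n) : Set (Ed d)), F n x) atTop
        (𝓝 (ν B).toReal)) {K : Set (Ed d)} (hK : IsCompact K) (hKΩ : K ⊆ Ω) :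
    volume (nmapSet d Ω u K) ≤ ν K := by
  have hcont := hu.continuousOn ho hh hl
  obtain ⟨ρ, hρ, hρΩ, -⟩ := exists_pos_closedBall_subset_of_isCompact ho hK hKΩ
  obtain ⟨C, hC⟩ := exists_lipschitzWith_legendre hb hne hcont
  obtain ⟨rs, hrs, hrs'⟩ := exists_null_frontiers_thickening ν K
  refine ge_of_tendsto ((tendsto_measure_cthickening_of_isCompact (μ := ν) hK).comp hrs) ?_
  filter_upwards [hrs.eventually_lt_const hρ] with m hm
  obtain ⟨hr0, hr⟩ := hrs' m
  have hVΩ : Metric.thickening (rs m) K ⊆ Ω := (Metric.thickening_subset_cthickening _ _).trans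
    ((Metric.cthickening_mono hm.le K).trans hρΩ)
  refine le_trans ?_ (measure_mono (Metric.thickening_subset_cthickening (rs m) K))
  have hlim := ENNReal.tendsto_ofReal (hw _ hVΩ Metric.isOpen_thickening.measurableSet
    (measure_mono_null Set.inter_subset_left hr))
  rw [ENNReal.ofReal_toReal (measure_ne_top ν _)] at hlim
  refine le_trans (measure_mono_ae ?_)
    (volume_eventually_mem_le (fun n => (hs n).volume_biUnion_le hb (hh n) _) hlim)
  filter_upwards [hC.ae_differentiableAt (μ := volume)] with p hp hpK
  obtain ⟨x, hx, hpx⟩ := mem_nmapSet.mp hpK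
  exact hu.eventually_mem_biUnion ho hb hh hl i Metric.isOpen_thickening (hKΩ hx)
    (Metric.self_subset_thickening hr0 K hx) hpx hp

/-- A normal mapping with the right volumes on compact sets represents the measure. -/
lemma volume_nmapSet_eq_of_isCompact {d : ℕ} {Ω : Set (Ed d)} (ho : IsOpen Ω)
    (hb : Bornology.IsBounded Ω) {u : Ed d → ℝ} {ν : Measure (Ed d)} [IsFiniteMeasure ν]
    (H : ∀ K, IsCompact K → K ⊆ Ω → volume (nmapSet d Ω u K) = ν K) {B : Set (Ed d)}
    (hBΩ : B ⊆ Ω) (hB : MeasurableSet B) : volume (nmapSet d Ω u B) = ν B := by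
  apply le_antisymm
  · refine le_of_forall_gt fun r hr => ?_
    obtain ⟨O, hBO, hO, hOr⟩ := B.exists_isOpen_lt_of_lt r hr
    obtain ⟨F, hFc, hFs, hFU, hFm⟩ := (hO.inter ho).exists_iUnion_isClosed
    have hFΩ : ∀ n, F n ⊆ Ω := fun n => (hFs n).trans Set.inter_subset_right
    have h1 : nmapSet d Ω u B ⊆ ⋃ n, nmapSet d Ω u (F n) := fun p hp => by
      obtain ⟨x, hx, hpx⟩ := mem_nmapSet.mp hp
      have : x ∈ ⋃ n, F n := hFU ▸ ⟨hBO hx, hBΩ hx⟩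
      obtain ⟨n, hn⟩ := Set.mem_iUnion.mp this
      exact Set.mem_iUnion.mpr ⟨n, mem_nmapSet.mpr ⟨x, hn, hpx⟩⟩
    have hmono : Monotone fun n => nmapSet d Ω u (F n) := fun m n hmn => nmapSet_mono (hFm hmn)
    refine lt_of_le_of_lt (measure_mono h1) (lt_of_le_of_lt ?_ hOr)
    rw [hmono.measure_iUnion]
    refine iSup_le fun n => ?_
    rw [H (F n) (Metric.isCompact_of_isClosed_isBounded (hFc n) (hb.subset (hFΩ n))) (hFΩ n)]
    exact measure_mono ((hFs n).trans Set.inter_subset_left)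
  · refine le_of_forall_lt fun r hr => ?_
    obtain ⟨K, hKB, hK, hrK⟩ := hB.exists_lt_isCompact_of_ne_top (measure_ne_top ν B) hr
    rw [← H K hK (hKB.trans hBΩ)] at hrK
    exact hrK.trans_le (measure_mono (nmapSet_mono hKB))

/-- A Lipschitz function whose derivative vanishes almost everywhere is constant. -/
lemma eq_of_ae_hasFDerivAt_zero {d : ℕ} {ψ : Ed d → ℝ} {C : NNReal} (hψ : LipschitzWith C ψ)
    (H : ∀ᵐ p, HasFDerivAt ψ (0 : Ed d →L[ℝ] ℝ) p) (x y : Ed d) : ψ x = ψ y := by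
  set v := y - x with hv
  set S : Set (Ed d) := {p | DifferentiableAt ℝ ψ p} ∩ {p | fderiv ℝ ψ p = 0} with hS
  have hSm : MeasurableSet S := (measurableSet_of_differentiableAt ℝ ψ).inter
    ((measurable_fderiv ℝ ψ) (measurableSet_singleton 0))
  have hSae : ∀ᵐ p, p ∈ S := H.mono fun p hp => ⟨hp.differentiableAt, hp.fderiv⟩
  have h1 : ∀ᵐ t : ℝ, ∀ᵐ q : Ed d, q + t • v ∈ S := Eventually.of_forall fun t =>
    (measurePreserving_add_right volume (t • v)).quasiMeasurePreserving.ae hSae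
  have hcont : Measurable fun z : ℝ × Ed d => z.2 + z.1 • v := by fun_prop
  rw [Measure.ae_ae_comm (p := fun (t : ℝ) (q : Ed d) => q + t • v ∈ S) (hcont hSm)] at h1
  have h2 : (fun q => ψ (q + v)) =ᵐ[volume] ψ := by
    filter_upwards [h1] with q hq
    have hlip : LipschitzWith (C * ‖v‖₊) fun t : ℝ => ψ (q + t • v) := by
      refine hψ.comp (LipschitzWith.of_dist_le_mul fun s t => ?_)
      rw [dist_add_left, dist_eq_norm, ← sub_smul, norm_smul, dist_eq_norm, mul_comm]
      rfl
    have h3 := (hlip.lipschitzOnWith (s := Set.uIcc 0 1)).absolutelyContinuousOnInterval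
      |>.integral_deriv_eq_sub
    have h4 : ∀ᵐ t : ℝ, deriv (fun t : ℝ => ψ (q + t • v)) t = 0 := by
      filter_upwards [hq] with t ht
      have h5 : HasFDerivAt ψ (0 : Ed d →L[ℝ] ℝ) (q + t • v) := ht.2 ▸ ht.1.hasFDerivAt
      have h6 : HasDerivAt (fun t : ℝ => q + t • v) v t := by
        simpa using ((hasDerivAt_id t).smul_const v).const_add q
      simpa [Function.comp_def] using (h5.comp_hasDerivAt t h6).deriv
    rw [intervalIntegral.integral_congr_ae (g := fun _ => 0) (h4.mono fun t ht _ => ht)] at h3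
    simp only [intervalIntegral.integral_zero, one_smul, zero_smul, add_zero] at h3
    linarith
  have h3 := (Continuous.ae_eq_iff_eq volume
    (hψ.continuous.comp (continuous_id.add continuous_const)) hψ.continuous).mp h2
  have h4 : ψ (x + v) = ψ x := congrFun h3 x
  rw [← h4, hv, add_sub_cancel]

lemma measurableSet_nmapSet {d : ℕ} {Ω : Set (Ed d)} (ho : IsOpen Ω)
    (hb : Bornology.IsBounded Ω) {u : Ed d → ℝ} (hu : ContinuousOn u Ω) {G : Set (Ed d)}
    (hG : IsOpen G) (hGΩ : G ⊆ Ω) : MeasurableSet (nmapSet d Ω u G) := by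
  obtain ⟨F, hFc, hFs, hFU, -⟩ := hG.exists_iUnion_isClosed
  have h1 : nmapSet d Ω u G = ⋃ n, nmapSet d Ω u (F n) := by
    simp only [nmapSet]
    rw [← hFU, Set.biUnion_iUnion]
  rw [h1]
  refine MeasurableSet.iUnion fun n => (isCompact_nmapSet ho hu
    (Metric.isCompact_of_isClosed_isBounded (hFc n) (hb.subset ((hFs n).trans hGΩ)))
    ((hFs n).trans hGΩ)).measurableSet

lemma mem_of_lt_of_eq_frontier {d : ℕ} {Ω : Set (Ed d)} (ho : IsOpen Ω) {u v : Ed d → ℝ}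
    (huv : ∀ x ∈ frontier Ω, u x = v x) {x : Ed d} (hx : x ∈ closure Ω) (h : u x < v x) :
    x ∈ Ω := by
  by_contra hxΩ
  exact h.ne (huv x (ho.frontier_eq ▸ ⟨hx, hxΩ⟩))

/-- The comparison of normal images by sliding hyperplanes. -/
lemma nmapSet_superlevel_subset {d : ℕ} {Ω : Set (Ed d)} (ho : IsOpen Ω)
    (hb : Bornology.IsBounded Ω) {u v : Ed d → ℝ} (hu : ContinuousOn u (closure Ω))
    (hv : ContinuousOn v (closure Ω)) (huv : ∀ x ∈ frontier Ω, u x = v x) {t : ℝ} (ht : 0 ≤ t) :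
    nmapSet d Ω v {x ∈ Ω | u x + t < v x} ⊆ nmapSet d Ω u {x ∈ Ω | u x + t < v x} := by
  intro p hp
  obtain ⟨x, ⟨hx, hxt⟩, hpx⟩ := mem_nmapSet.mp hp
  obtain ⟨y, hy, hpy⟩ := exists_legendre_eq hb ⟨x, hx⟩ hu p
  have h1 := sub_le_legendre hb hu (subset_closure hx) p
  have h2 := mem_nmap_closure hv hpx hy
  rw [inner_sub_right] at h2
  have hyΩ : y ∈ Ω := mem_of_lt_of_eq_frontier ho huv hy (by linarith)
  exact mem_nmapSet.mpr ⟨y, ⟨hyΩ, by linarith⟩, (mem_nmap_iff_legendre hb hu hyΩ).mpr hpy⟩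

/-- For almost every slope the normal images of the superlevel sets agree. -/
lemma ae_mem_nmapSet_superlevel {d : ℕ} {Ω : Set (Ed d)} (ho : IsOpen Ω)
    (hb : Bornology.IsBounded Ω) {u v : Ed d → ℝ} (hu : ContinuousOn u (closure Ω))
    (hv : ContinuousOn v (closure Ω)) (huv : ∀ x ∈ frontier Ω, u x = v x)
    {ν : Measure (Ed d)} [IsFiniteMeasure ν]
    (hνu : ∀ B ⊆ Ω, MeasurableSet B → volume (nmapSet d Ω u B) = ν B)
    (hνv : ∀ B ⊆ Ω, MeasurableSet B → volume (nmapSet d Ω v B) = ν B) {t : ℝ} (ht : 0 ≤ t) :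
    ∀ᵐ p, p ∈ nmapSet d Ω u {x ∈ Ω | u x + t < v x} →
      p ∈ nmapSet d Ω v {x ∈ Ω | u x + t < v x} := by
  set G := {x ∈ Ω | u x + t < v x} with hG
  have hGΩ : G ⊆ Ω := fun x hx => hx.1
  have hu' := hu.mono subset_closure
  have hv' := hv.mono subset_closure
  have hGo : IsOpen G := by
    have := (hv'.sub (hu'.add (continuousOn_const (c := t)))).isOpen_inter_preimage ho
      (isOpen_Ioi (a := (0 : ℝ)))
    convert this using 1
    ext x
    simp [hG]
  have hm := measurableSet_nmapSet ho hb hv' hGo hGΩ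
  have hvol := hνv G hGΩ hGo.measurableSet
  have h1 : volume (nmapSet d Ω u G \ nmapSet d Ω v G) = 0 := by
    rw [measure_sdiff (nmapSet_superlevel_subset ho hb hu hv huv ht) hm.nullMeasurableSet
      (hvol ▸ measure_ne_top ν G), hvol, hνu G hGΩ hGo.measurableSet, tsub_self]
  have h2 := measure_eq_zero_iff_ae_notMem.mp h1
  filter_upwards [h2] with p hp hpu
  by_contra hpv
  exact hp ⟨hpu, hpv⟩

/-- Where the Legendre transform of `u` exceeds that of `v`, their gradients agree. -/
lemma fderiv_legendre_eq_of_lt {d : ℕ} {Ω : Set (Ed d)} (ho : IsOpen Ω)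
    (hb : Bornology.IsBounded Ω) (hne : Ω.Nonempty) {u v : Ed d → ℝ}
    (hu : ContinuousOn u (closure Ω)) (hv : ContinuousOn v (closure Ω))
    (huv : ∀ x ∈ frontier Ω, u x = v x) {p : Ed d}
    (hpu : DifferentiableAt ℝ (legendre d Ω u) p) (hpv : DifferentiableAt ℝ (legendre d Ω v) p)
    (H : ∀ t : ℚ, 0 ≤ t → p ∈ nmapSet d Ω u {x ∈ Ω | u x + t < v x} →
      p ∈ nmapSet d Ω v {x ∈ Ω | u x + t < v x})
    (hlt : legendre d Ω v p < legendre d Ω u p) :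
    fderiv ℝ (legendre d Ω u) p = fderiv ℝ (legendre d Ω v) p := by
  obtain ⟨x, hx, hpx⟩ := exists_legendre_eq hb hne hu p
  obtain ⟨y, hy, hpy⟩ := exists_legendre_eq hb hne hv p
  have h1 := sub_le_legendre hb hv hx p
  have hxΩ : x ∈ Ω := mem_of_lt_of_eq_frontier ho huv hx (by linarith)
  have h2 : v x - u x ≤ v y - u y := by
    by_contra! hcon
    obtain ⟨t, ht1, ht2⟩ := exists_rat_btwn
      (max_lt hcon (show (0 : ℝ) < v x - u x by linarith))
    have ht0 : (0 : ℚ) ≤ t := by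
      exact_mod_cast ((le_max_right _ _).trans_lt ht1).le
    obtain ⟨z, ⟨hz, hzt⟩, hpz⟩ := mem_nmapSet.mp (H t ht0 (mem_nmapSet.mpr
      ⟨x, ⟨hxΩ, by linarith⟩, (mem_nmap_iff_legendre hb hu hxΩ).mpr hpx⟩))
    have h3 := eq_of_legendre_eq hb hv hpv hy (subset_closure hz) hpy
      ((mem_nmap_iff_legendre hb hv hz).mp hpz)
    rw [← h3] at hzt
    linarith [(le_max_left (v y - u y) 0).trans_lt ht1]
  have h3 := sub_le_legendre hb hu hy p
  rw [fderiv_legendre_eq hb hv hpv hy hpy,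
    fderiv_legendre_eq hb hu hpu hy (by linarith)]

/-- The comparison principle for equal Monge–Ampère measures. -/
theorem le_of_volume_nmapSet_eq {d : ℕ} (hd : 0 < d) {Ω : Set (Ed d)} (ho : IsOpen Ω)
    (hb : Bornology.IsBounded Ω) (hne : Ω.Nonempty) {u v : Ed d → ℝ}
    (hu : ContinuousOn u (closure Ω)) (hv : ContinuousOn v (closure Ω)) (hvc : ConvexOn ℝ Ω v)
    (huv : ∀ x ∈ frontier Ω, u x = v x) {ν : Measure (Ed d)} [IsFiniteMeasure ν]
    (hνu : ∀ B ⊆ Ω, MeasurableSet B → volume (nmapSet d Ω u B) = ν B)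
    (hνv : ∀ B ⊆ Ω, MeasurableSet B → volume (nmapSet d Ω v B) = ν B)
    {x : Ed d} (hx : x ∈ closure Ω) : v x ≤ u x := by
  obtain ⟨C₁, hC₁⟩ := exists_lipschitzWith_legendre hb hne hu
  obtain ⟨C₂, hC₂⟩ := exists_lipschitzWith_legendre hb hne hv
  set φ : Ed d → ℝ := fun p => legendre d Ω u p - legendre d Ω v p with hφ
  have hφl : LipschitzWith (C₁ + C₂) φ := hC₁.sub hC₂
  have hae : ∀ᵐ p, HasFDerivAt (fun p => max (φ p) 0) (0 : Ed d →L[ℝ] ℝ) p := by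
    have hq : ∀ᵐ p, ∀ t : ℚ, 0 ≤ t → p ∈ nmapSet d Ω u {x ∈ Ω | u x + t < v x} →
        p ∈ nmapSet d Ω v {x ∈ Ω | u x + t < v x} := by
      rw [ae_all_iff]
      intro t
      rw [eventually_imp_distrib_left]
      intro ht
      exact ae_mem_nmapSet_superlevel ho hb hu hv huv hνu hνv (by exact_mod_cast ht)
    filter_upwards [hq, hC₁.ae_differentiableAt (μ := volume),
      hC₂.ae_differentiableAt (μ := volume),
      (hφl.max_const 0).ae_differentiableAt (μ := volume)] with p hp hpu hpv hpm
    rcases lt_or_ge 0 (φ p) with h0 | h0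
    · have h1 : HasFDerivAt φ (fderiv ℝ (legendre d Ω u) p - fderiv ℝ (legendre d Ω v) p) p :=
        hpu.hasFDerivAt.sub hpv.hasFDerivAt
      rw [fderiv_legendre_eq_of_lt ho hb hne hu hv huv hpu hpv hp (sub_pos.mp h0), sub_self] at h1
      refine h1.congr_of_eventuallyEq ?_
      filter_upwards [hφl.continuous.continuousAt.eventually (lt_mem_nhds h0)] with q hq
      exact max_eq_left hq.le
    · have hmin : IsLocalMin (fun p => max (φ p) 0) p := Eventually.of_forall fun q => by
        simp only [max_eq_right h0]
        exact le_max_right _ _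
      have h1 := hpm.hasFDerivAt
      rwa [hmin.fderiv_eq_zero] at h1
  have hconst := eq_of_ae_hasFDerivAt_zero (hφl.max_const 0) hae
  have hle : ∀ p, φ p ≤ 0 := by
    by_contra! hcon
    obtain ⟨p₀, hp₀⟩ := hcon
    have huniv : nmapSet d Ω u Ω = Set.univ := by
      refine Set.eq_univ_of_forall fun p => ?_
      have h1 := hconst p p₀
      simp only [max_eq_left hp₀.le] at h1
      have h2 : 0 < φ p := by
        by_contra! h
        rw [max_eq_right h] at h1
        exact hp₀.ne h1
      obtain ⟨z, hz, hpz⟩ := exists_legendre_eq hb hne hu p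
      have h3 := sub_le_legendre hb hv hz p
      have h4 := sub_pos.mp h2
      have hzΩ : z ∈ Ω := mem_of_lt_of_eq_frontier ho huv hz (by linarith)
      exact mem_nmapSet.mpr ⟨z, hzΩ, (mem_nmap_iff_legendre hb hu hzΩ).mpr hpz⟩
    have : NeZero d := ⟨hd.ne'⟩
    have h1 := hνu Ω subset_rfl ho.measurableSet
    rw [huniv, measure_univ_of_isAddLeftInvariant] at h1
    exact measure_ne_top ν Ω h1.symm
  refine le_of_forall_pos_le_add fun ε hε => ?_
  obtain ⟨q, c, hq, hqx⟩ := exists_affine_minorant hv hvc hx (show v x - ε < v x by linarith)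
  obtain ⟨y, hy, hqy⟩ := exists_legendre_eq hb hne hv q
  have h1 := hq y hy
  have h2 := sub_le_legendre hb hu hx q
  have h3 := sub_nonpos.mp (hle q)
  linarith

/-- `u` is an Aleksandrov solution of the Dirichlet problem `det D²u = ν`, `u = g` on `∂Ω`. -/
structure AleksandrovSol (d : ℕ) (Ω : Set (Ed d)) (ν : Measure (Ed d)) (g u : Ed d → ℝ) :
    Prop where
  cont : ContinuousOn u (closure Ω)
  conv : ConvexOn ℝ Ω u
  meas : ∀ B : Set (Ed d), B ⊆ Ω → MeasurableSet B → volume (nmapSet d Ω u B) = ν B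
  bdry : ∀ x ∈ frontier Ω, u x = g x

/-- Aleksandrov solutions are unique. -/
lemma AleksandrovSol.eq {d : ℕ} (hd : 0 < d) {Ω : Set (Ed d)} (ho : IsOpen Ω)
    (hb : Bornology.IsBounded Ω) {ν : Measure (Ed d)} [IsFiniteMeasure ν] {g u v : Ed d → ℝ}
    (hu : AleksandrovSol d Ω ν g u) (hv : AleksandrovSol d Ω ν g v) {x : Ed d}
    (hx : x ∈ closure Ω) : u x = v x := by
  have hne : Ω.Nonempty := closure_nonempty_iff.mp ⟨x, hx⟩
  have h1 : ∀ y ∈ frontier Ω, u y = v y := fun y hy => (hu.bdry y hy).trans (hv.bdry y hy).symm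
  exact le_antisymm
    (le_of_volume_nmapSet_eq hd ho hb hne hv.cont hu.cont hu.conv (fun y hy => (h1 y hy).symm)
      hv.meas hu.meas hx)
    (le_of_volume_nmapSet_eq hd ho hb hne hu.cont hv.cont hv.conv h1 hu.meas hv.meas hx)

/-- Limits of discrete solutions are Aleksandrov solutions. -/
lemma MeshLim.aleksandrovSol {d : ℕ} (hd : 0 < d) {Ω : Set (Ed d)} (ho : IsOpen Ω)
    (hc : Convex ℝ Ω) (hb : Bornology.IsBounded Ω) (hne : Ω.Nonempty) {g : Ed d → ℝ}
    (hg : ContinuousOn g (closure Ω)) (hgc : ConvexOn ℝ Ω g) {h : ℕ → ℝ} (hh : ∀ n, 0 < h n)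
    (hl : Tendsto h atTop (𝓝 0)) {i : ℕ} {A : ℝ} {F U : ℕ → Ed d → ℝ}
    (hs : ∀ n, MeshSol i d Ω g A (h n) (F n) (U n)) {u : Ed d → ℝ} (hu : MeshLim d Ω h U u)
    {ν : Measure (Ed d)} [IsFiniteMeasure ν]
    (hw : ∀ B ⊆ Ω, MeasurableSet B → ν (frontier B ∩ Ω) = 0 →
      Tendsto (fun n => h n ^ d * ∑' x : (B ∩ meshInt d Ω (h n) : Set (Ed d)), F n x) atTop
        (𝓝 (ν B).toReal)) : AleksandrovSol d Ω ν g u := by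
  obtain ⟨x₀, hx₀⟩ := frontier_nonempty_of_isBounded hd hb hne
  obtain ⟨C, hC, hbd⟩ := exists_uniform_bound hd ho hc hb hg hgc A hx₀
  refine ⟨hu.continuousOn ho hh hl, hu.convexOn ho hc hh hl fun n => (hs n).conv,
    fun B hB hBm => ?_, fun x hx => hu.eq_of_mem_frontier hd ho hc hb hg hgc hh hl hs hx⟩
  exact volume_nmapSet_eq_of_isCompact ho hb (fun K hK hKΩ => le_antisymm
    (hu.volume_nmapSet_le ho hb hne hh hl hs hw hK hKΩ)
    (hu.measure_le_volume_nmapSet ho hc hb hh hl hs hC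
      (fun n => hbd i _ _ _ (hh n) (hs n)) hw hK hKΩ)) hB hBm

/-- A family of discrete solutions whose subsequential limits all coincide converges. -/
lemma cvgUnifCpt_of_meshLim_unique {d : ℕ} (hd : 0 < d) {Ω : Set (Ed d)} (ho : IsOpen Ω)
    (hc : Convex ℝ Ω) (hb : Bornology.IsBounded Ω) (hne : Ω.Nonempty) {g : Ed d → ℝ}
    (hg : ContinuousOn g (closure Ω)) (hgc : ConvexOn ℝ Ω g) {i : ℕ} {A : ℝ}
    {f uh : ℝ → Ed d → ℝ} (hs : ∀ h, 0 < h → MeshSol i d Ω g A h (f h) (uh h)) {u : Ed d → ℝ}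
    (H : ∀ h : ℕ → ℝ, (∀ n, 0 < h n) → Tendsto h atTop (𝓝 0) → ∀ w,
      MeshLim d Ω h (fun n => uh (h n)) w → ∀ x ∈ closure Ω, w x = u x) :
    CvgUnifCpt d Ω uh u := by
  intro K hKΩ _ h hh hl ε hε
  rw [← eventually_atTop]
  by_contra hcon
  obtain ⟨φ, hφ, hfr⟩ := extraction_of_frequently_atTop (not_eventually.mp hcon)
  obtain ⟨ψ, hψ, w, hw⟩ := exists_subseq_meshLim hd ho hc hb hne hg hgc (h := h ∘ φ)
    (fun n => hh _) (hl.comp hφ.tendsto_atTop) (F := fun n => f (h (φ n)))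
    (U := fun n => uh (h (φ n))) fun n => hs _ (hh _)
  have hh' : ∀ n, 0 < (h ∘ φ ∘ ψ) n := fun n => hh _
  have hl' : Tendsto (h ∘ φ ∘ ψ) atTop (𝓝 0) := hl.comp (hφ.comp hψ).tendsto_atTop
  obtain ⟨n, hn⟩ := (MeshLim.eventually_abs_sub_lt ho hb hh' hl' hw hε).exists
  refine hfr (ψ n) fun x hx => ?_
  have hxc := subset_closure (hKΩ hx.1)
  rw [← H _ hh' hl' w hw x hxc]
  exact hn x ⟨hxc, hx.2⟩

/-- main convergence theorem: the discrete solutions converge uniformly on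
compact subsets to the unique Aleksandrov solution. -/
theorem stmt19 (d : ℕ) (hd : 0 < d) (i : ℕ) (hi : i = 1 ∨ i = 2)
    (Ω : Set (Ed d)) (hΩo : IsOpen Ω) (hΩconv : Convex ℝ Ω) (hΩb : Bornology.IsBounded Ω)
    (ν : Measure (Ed d)) (hν : IsFiniteMeasure ν)
    (g gext : Ed d → ℝ) (hg : ContinuousOn g (frontier Ω))
    (hgext_cont : ContinuousOn gext (closure Ω)) (hgext_conv : ConvexOn ℝ Ω gext)
    (hext : ∀ x ∈ frontier Ω, gext x = g x)
    (f : ℝ → Ed d → ℝ) (hf_nonneg : ∀ h : ℝ, 0 < h → ∀ x ∈ meshInt d Ω h, 0 ≤ f h x)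
    (hweak : ∀ hk : ℕ → ℝ, (∀ n, 0 < hk n) → Tendsto hk atTop (𝓝 0) →
      ∀ B : Set (Ed d), B ⊆ Ω → MeasurableSet B → ν (frontier B ∩ Ω) = 0 →
      Tendsto (fun k => (hk k) ^ d * ∑' x : (B ∩ meshInt d Ω (hk k) : Set (Ed d)), f (hk k) x)
        atTop (𝓝 (ν B).toReal))
    (A : ℝ) (hA : ∀ h : ℝ, 0 < h → h ^ d * ∑' x : meshInt d Ω h, f h x ≤ A)
    (uh : ℝ → Ed d → ℝ)
    (huh_conv : ∀ h : ℝ, 0 < h → DiscConvex d Ω h (uh h))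
    (huh_eq : ∀ h : ℝ, 0 < h → ∀ x ∈ meshInt d Ω h,
      volume (subdiffI i d Ω h (uh h) x) = ENNReal.ofReal (h ^ d * f h x))
    (huh_bc : ∀ h : ℝ, 0 < h → ∀ x ∈ (closure Ω ∩ lat d h) \ meshInt d Ω h,
      uh h x = gext x) :
    ∃ u : Ed d → ℝ,
      (ContinuousOn u (closure Ω) ∧ ConvexOn ℝ Ω u ∧
        (∀ B : Set (Ed d), B ⊆ Ω → MeasurableSet B → volume (nmapSet d Ω u B) = ν B) ∧
        (∀ x ∈ frontier Ω, u x = g x)) ∧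
      (∀ v : Ed d → ℝ,
        (ContinuousOn v (closure Ω) ∧ ConvexOn ℝ Ω v ∧
          (∀ B : Set (Ed d), B ⊆ Ω → MeasurableSet B → volume (nmapSet d Ω v B) = ν B) ∧
          (∀ x ∈ frontier Ω, v x = g x)) →
        ∀ x ∈ closure Ω, v x = u x) ∧
      CvgUnifCpt d Ω uh u := by
  have hs : ∀ h, 0 < h → MeshSol i d Ω gext A h (f h) (uh h) := fun h hh =>
    ⟨huh_conv h hh, hf_nonneg h hh, huh_eq h hh, huh_bc h hh, hA h hh⟩
  rcases Ω.eq_empty_or_nonempty with rfl | hne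
  · refine ⟨fun _ => 0, ⟨by simp, ⟨convex_empty, by simp⟩, fun B hB _ => ?_, by simp⟩, by simp,
      fun K hK _ h _ _ ε _ => ⟨0, fun n _ x hx => absurd (hK hx.1) (Set.notMem_empty x)⟩⟩
    rw [Set.subset_empty_iff.mp hB]
    simp [nmapSet]
  have hsol : ∀ h : ℕ → ℝ, (∀ n, 0 < h n) → Tendsto h atTop (𝓝 0) → ∀ w,
      MeshLim d Ω h (fun n => uh (h n)) w → AleksandrovSol d Ω ν gext w := fun h hh hl w hw =>
    hw.aleksandrovSol hd hΩo hΩconv hΩb hne hgext_cont hgext_conv hh hl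
      (F := fun n => f (h n)) (fun n => hs _ (hh n)) (hweak h hh hl)
  obtain ⟨φ, hφ, u, hu⟩ := exists_subseq_meshLim hd hΩo hΩconv hΩb hne hgext_cont hgext_conv
    (h := fun n : ℕ => 1 / ((n : ℝ) + 1)) (fun n => Nat.one_div_pos_of_nat)
    tendsto_one_div_add_atTop_nhds_zero_nat (F := fun n : ℕ => f (1 / ((n : ℝ) + 1)))
    (U := fun n : ℕ => uh (1 / ((n : ℝ) + 1))) fun n => hs _ Nat.one_div_pos_of_nat
  have hus : AleksandrovSol d Ω ν gext u := hsol _ (fun n => Nat.one_div_pos_of_nat)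
    (tendsto_one_div_add_atTop_nhds_zero_nat.comp hφ.tendsto_atTop) u hu
  refine ⟨u, ⟨hus.cont, hus.conv, hus.meas, fun x hx => (hus.bdry x hx).trans (hext x hx)⟩,
    fun v hv x hx => ?_, ?_⟩
  · exact AleksandrovSol.eq hd hΩo hΩb ⟨hv.1, hv.2.1, hv.2.2.1,
      fun y hy => (hv.2.2.2 y hy).trans (hext y hy).symm⟩ hus hx
  · exact cvgUnifCpt_of_meshLim_unique hd hΩo hΩconv hΩb hne hgext_cont hgext_conv hs
      fun h hh hl w hw x hx => (hsol h hh hl w hw).eq hd hΩo hΩb hus hx
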